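/- arXiv:2205.15352 — 4 statements merged into one kernel-verified Lean document; each statement's English description precedes it below -/
import Mathlib

section
/- Let g ≥ 1 and let ρ : π_g → GL_r(ℂ) be a representation of the genus-g surface group which has finite orbit under Aut(π_g) (equivalently, ρ is MCG-finite). Then the composite det ∘ ρ : π_g → ℂ^× has finite image. (This is the closed-surface case of the paper's lemma that MCG-finite representations have finite determinant.) -/
open scoped commutatorElement

/-- The standard relator `[a₁,b₁]⋯[a_g,b_g]` of the genus-`g` surface group,
with generators indexed by `Fin g × Bool` (`(i, false)` is `aᵢ`, `(i, true)` is `bᵢ`). -/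
noncomputable abbrev surfaceRelator (g : ℕ) : FreeGroup (Fin g × Bool) :=
  ((List.finRange g).map fun i => ⁅FreeGroup.of (i, false), FreeGroup.of (i, true)⁆).prod

/-- The genus-`g` surface group `π_g`. -/
noncomputable abbrev SurfaceGroup (g : ℕ) : Type :=
  PresentedGroup ({surfaceRelator g} : Set (FreeGroup (Fin g × Bool)))

/-- Two representations are conjugate if they differ by a global conjugation. -/
def RepConj {G : Type*} [Group G] {r : ℕ}
    (ρ ρ' : G →* GL (Fin r) ℂ) : Prop :=
  ∃ M : GL (Fin r) ℂ, ∀ x, ρ' x = M * ρ x * M⁻¹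

/-- `ρ` has finite orbit under `Aut G`: the representations `ρ ∘ φ`, for `φ ∈ Aut G`,
fall into finitely many conjugacy classes. -/
def FiniteAutOrbit {G : Type*} [Group G] {r : ℕ}
    (ρ : G →* GL (Fin r) ℂ) : Prop :=
  ∃ s : Set (G →* GL (Fin r) ℂ), s.Finite ∧
    ∀ φ : MulAut G, ∃ ρ' ∈ s, RepConj (ρ.comp φ.toMonoidHom) ρ'

/-- Multiply the generator `(i, c)` on the right by the `n`-th power of its dual generator
`(i, !c)`, fixing the other generators. -/
noncomputable def transvectionGen (g : ℕ) (i : Fin g) (c : Bool) (n : ℤ)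
    (p : Fin g × Bool) : SurfaceGroup g :=
  if p = (i, c) then PresentedGroup.of (i, c) * PresentedGroup.of (i, !c) ^ n
  else PresentedGroup.of p

lemma commutatorElement_mul_zpow_right {G : Type*} [Group G] (a b : G) (n : ℤ) :
    ⁅a, b * a ^ n⁆ = ⁅a, b⁆ := by
  have h : a ^ n * a⁻¹ = a⁻¹ * a ^ n := ((Commute.refl a).inv_right.zpow_left n).eq
  simp only [commutatorElement_def, mul_inv_rev]
  calc a * (b * a ^ n) * a⁻¹ * ((a ^ n)⁻¹ * b⁻¹)
      = a * b * (a ^ n * a⁻¹) * (a ^ n)⁻¹ * b⁻¹ := by group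
    _ = a * b * a⁻¹ * b⁻¹ := by rw [h]; group

lemma commutatorElement_mul_zpow_left {G : Type*} [Group G] (a b : G) (n : ℤ) :
    ⁅a * b ^ n, b⁆ = ⁅a, b⁆ := by
  rw [← commutatorElement_inv b, commutatorElement_mul_zpow_right, commutatorElement_inv]

lemma lift_transvectionGen_surfaceRelator (g : ℕ) (i : Fin g) (c : Bool) (n : ℤ) :
    FreeGroup.lift (transvectionGen g i c n) (surfaceRelator g) = 1 := by
  have h : FreeGroup.lift (transvectionGen g i c n) (surfaceRelator g) =
      PresentedGroup.mk {surfaceRelator g} (surfaceRelator g) := by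
    simp only [surfaceRelator, map_list_prod, List.map_map]
    congr 1
    refine List.map_congr_left fun j _ => ?_
    simp only [Function.comp_apply, map_commutatorElement, FreeGroup.lift_apply_of]
    change _ = ⁅PresentedGroup.of (j, false), PresentedGroup.of (j, true)⁆
    by_cases hj : j = i
    · subst hj
      cases c
      · simp [transvectionGen, commutatorElement_mul_zpow_left]
      · simp [transvectionGen, commutatorElement_mul_zpow_right]
    · simp [transvectionGen, hj]
  rw [h]
  exact PresentedGroup.one_of_mem rfl

/-- The endomorphism of the surface group induced by `transvectionGen`. -/
noncomputable def transvectionHom (g : ℕ) (i : Fin g) (c : Bool) (n : ℤ) :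
    SurfaceGroup g →* SurfaceGroup g :=
  PresentedGroup.toGroup (f := transvectionGen g i c n) <| by
    rintro _ rfl
    exact lift_transvectionGen_surfaceRelator g i c n

lemma transvectionHom_of (g : ℕ) (i : Fin g) (c : Bool) (n : ℤ) (p : Fin g × Bool) :
    transvectionHom g i c n (PresentedGroup.of p) = transvectionGen g i c n p :=
  PresentedGroup.toGroup.of _

lemma transvectionHom_comp_neg (g : ℕ) (i : Fin g) (c : Bool) (n : ℤ) :
    (transvectionHom g i c n).comp (transvectionHom g i c (-n)) = MonoidHom.id _ := by
  refine PresentedGroup.ext fun p => ?_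
  rw [MonoidHom.comp_apply, transvectionHom_of, MonoidHom.id_apply]
  by_cases hp : p = (i, c)
  · subst hp
    simp [transvectionGen, transvectionHom_of]
  · simp [transvectionGen, transvectionHom_of, hp]

/-- The automorphism of the surface group multiplying the generator `(i, c)` on the right by the
`n`-th power of its dual generator: a power of a Dehn twist. -/
noncomputable def transvection (g : ℕ) (i : Fin g) (c : Bool) (n : ℤ) :
    MulAut (SurfaceGroup g) :=
  MonoidHom.toMulEquiv (transvectionHom g i c n) (transvectionHom g i c (-n))
    (by simpa using transvectionHom_comp_neg g i c (-n)) (transvectionHom_comp_neg g i c n)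

lemma transvection_apply_of (g : ℕ) (i : Fin g) (c : Bool) (n : ℤ) :
    transvection g i c n (PresentedGroup.of (i, c)) =
      PresentedGroup.of (i, c) * PresentedGroup.of (i, !c) ^ n := by
  change transvectionHom g i c n (PresentedGroup.of (i, c)) = _
  rw [transvectionHom_of, transvectionGen, if_pos rfl]

/-- The determinants of an element along a finite automorphism orbit take finitely many values. -/
lemma FiniteAutOrbit.finite_det {G : Type*} [Group G] {r : ℕ} {ρ : G →* GL (Fin r) ℂ}
    (h : FiniteAutOrbit ρ) (x : G) :
    (Set.range fun φ : MulAut G => Matrix.GeneralLinearGroup.det (ρ (φ x))).Finite := by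
  obtain ⟨s, hs, hφ⟩ := h
  refine (hs.image fun ρ' => Matrix.GeneralLinearGroup.det (ρ' x)).subset ?_
  rintro _ ⟨φ, rfl⟩
  obtain ⟨ρ', hρ', M, hM⟩ := hφ φ
  refine ⟨ρ', hρ', ?_⟩
  simp [hM x]

/-- Along a representation with finite automorphism orbit, the standard generators have
determinants of finite order. -/
lemma FiniteAutOrbit.isOfFinOrder_det_of {g r : ℕ} {ρ : SurfaceGroup g →* GL (Fin r) ℂ}
    (h : FiniteAutOrbit ρ) (p : Fin g × Bool) :
    IsOfFinOrder (Matrix.GeneralLinearGroup.det (ρ (PresentedGroup.of p))) := by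
  obtain ⟨i, c⟩ := p
  by_contra hx
  refine Set.infinite_range_of_injective (injective_zpow_iff_not_isOfFinOrder.2 hx) ?_
  refine Set.Finite.of_finite_image ((h.finite_det (PresentedGroup.of (i, !c))).subset ?_)
    (mul_right_injective
      (Matrix.GeneralLinearGroup.det (ρ (PresentedGroup.of (i, !c))))).injOn
  rintro _ ⟨_, ⟨n, rfl⟩, rfl⟩
  exact ⟨transvection g i (!c) n, by simp [transvection_apply_of]⟩

/-- An MCG-finite representation of the genus-`g` surface group, `g ≥ 1`, has finite
determinant: the composite `det ∘ ρ : π_g → ℂ^×` has finite image. -/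
theorem finite_determinant_of_MCG_finite (g r : ℕ) (hg : 1 ≤ g)
    (ρ : SurfaceGroup g →* GL (Fin r) ℂ)
    (hfin : FiniteAutOrbit ρ) :
    Set.Finite (Set.range fun x => Matrix.GeneralLinearGroup.det (ρ x)) := by
  set χ : SurfaceGroup g →* ℂˣ := Matrix.GeneralLinearGroup.det.comp ρ
  set N := ∏ p : Fin g × Bool, orderOf (χ (PresentedGroup.of p))
  have hN0 : NeZero N :=
    ⟨Finset.prod_ne_zero_iff.2 fun p _ => (hfin.isOfFinOrder_det_of p).orderOf_pos.ne'⟩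
  have hone : χ ^ N = 1 := PresentedGroup.ext fun p =>
    orderOf_dvd_iff_pow_eq_one.1 (Finset.dvd_prod_of_mem _ (Finset.mem_univ p))
  have hroots : (rootsOfUnity N ℂ : Set ℂˣ).Finite :=
    Set.finite_coe_iff.1 (inferInstance : Finite (rootsOfUnity N ℂ))
  refine hroots.subset ?_
  rintro _ ⟨x, rfl⟩
  exact DFunLike.congr_fun hone x
end

section
/- Let N ⊴ G be groups with quotient Q = G/N, and let ρ₀ : G → GL_r(ℂ) be a representation. For n ≥ 0 write B_n = ℂ[t]/(t^{n+1}). Suppose that for every n ≥ 0 and every representation γ : G → GL_r(B_n) with γ ≡ ρ₀ (mod t) and with γ|_N constant (i.e. γ(ν) ∈ GL_r(ℂ) ⊆ GL_r(B_n) for all ν ∈ N), one has H⁰(Q, H¹(N, ad γ|_N)) = 0, i.e.: every 1-cocycle c on N valued in ad γ such that, for each g ∈ G, the 1-cocycle ν ↦ γ(g)⁻¹ c(g ν g⁻¹) γ(g) differs from c by a 1-coboundary, is itself a 1-coboundary. Then for every representation ρ_∞ : G → GL_r(ℂ[[t]]) with ρ_∞ ≡ ρ₀ (mod t) and with constant determinant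 (det ρ_∞(g) = det ρ₀(g) ∈ ℂ ⊆ ℂ[[t]] for all g ∈ G), the restriction ρ_∞|_N is conjugate to a constant representation: there exists M_∞ ∈ GL_r(ℂ[[t]]) such that M_∞ ρ_∞(ν) M_∞⁻¹ ∈ GL_r(ℂ) (all matrix entries constant power series) for every ν ∈ N. -/
/-- `B_n = ℂ[t]/(t^{n+1})`. -/
noncomputable abbrev Bn (n : ℕ) : Type :=
  Polynomial ℂ ⧸ Ideal.span {(Polynomial.X : Polynomial ℂ) ^ (n + 1)}

/-- Reduction mod `t`, `B_n → ℂ` (evaluation at `0`). -/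
noncomputable def BnToC (n : ℕ) : Bn n →+* ℂ :=
  Ideal.Quotient.lift _ (Polynomial.evalRingHom 0) (by
    intro a ha
    rw [Ideal.mem_span_singleton] at ha
    obtain ⟨b, rfl⟩ := ha
    simp [zero_pow (Nat.succ_ne_zero n)])

/-- `c : N → sl_r(R)` is a 1-cocycle valued in `ad γ`:
`c(n n′) = c(n) + γ(n) c(n′) γ(n)⁻¹`. -/
def IsCocycle {G : Type*} [Group G] (N : Subgroup G) {r : ℕ} {R : Type*} [CommRing R]
    (γ : G →* GL (Fin r) R) (c : ↥N → Matrix (Fin r) (Fin r) R) : Prop :=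
  ∀ n m : ↥N, c (n * m) = c n + (γ ↑n).val * c m * ((γ ↑n)⁻¹).val

/-- `c : N → sl_r(R)` is a 1-coboundary: `c(n) = γ(n) m γ(n)⁻¹ − m` for some trace-zero
matrix `m`. -/
def IsCoboundary {G : Type*} [Group G] (N : Subgroup G) {r : ℕ} {R : Type*} [CommRing R]
    (γ : G →* GL (Fin r) R) (c : ↥N → Matrix (Fin r) (Fin r) R) : Prop :=
  ∃ m : Matrix (Fin r) (Fin r) R, m.trace = 0 ∧
    ∀ n : ↥N, c n = (γ ↑n).val * m * ((γ ↑n)⁻¹).val - m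

/-- `H⁰(Q, H¹(N, ad γ|_N)) = 0`: every 1-cocycle `c` on `N` valued in `ad γ` such that,
for each `g ∈ G`, the cocycle `n ↦ γ(g)⁻¹ c(g n g⁻¹) γ(g)` differs from `c` by a
coboundary, is itself a coboundary. -/
def H0H1Vanishes {G : Type*} [Group G] (N : Subgroup G) (hN : N.Normal) {r : ℕ}
    {R : Type*} [CommRing R] (γ : G →* GL (Fin r) R) : Prop :=
  ∀ c : ↥N → Matrix (Fin r) (Fin r) R,
    (∀ n, (c n).trace = 0) →
    IsCocycle N γ c →
    (∀ g : G, IsCoboundary N γ fun n =>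
      ((γ g)⁻¹).val * c ⟨g * ↑n * g⁻¹, hN.conj_mem ↑n n.2 g⟩ * (γ g).val - c n) →
    IsCoboundary N γ c

open PowerSeries in
theorem coeff_map_C_map_mul {r : ℕ} (k : ℕ) (P : Matrix (Fin r) (Fin r) ℂ)
    (A : Matrix (Fin r) (Fin r) (PowerSeries ℂ)) :
    (P.map (C (R := ℂ)) * A).map (coeff k) = P * A.map (coeff k) := by
  ext i j
  simp [Matrix.mul_apply, coeff_C_mul]

open PowerSeries in
theorem coeff_map_mul_C_map {r : ℕ} (k : ℕ) (P : Matrix (Fin r) (Fin r) ℂ)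
    (A : Matrix (Fin r) (Fin r) (PowerSeries ℂ)) :
    (A * P.map (C (R := ℂ))).map (coeff k) = A.map (coeff k) * P := by
  ext i j
  simp [Matrix.mul_apply, coeff_mul_C]

open PowerSeries in
theorem coeff_map_X_pow_smul {r : ℕ} (k : ℕ) (A : Matrix (Fin r) (Fin r) (PowerSeries ℂ)) :
    ((X : PowerSeries ℂ) ^ k • A).map (coeff k) = A.map (constantCoeff (R := ℂ)) := by
  ext i j
  simp [coeff_X_pow_mul']

open PowerSeries in
theorem constantCoeff_map_X_pow_succ_smul {r : ℕ} (k : ℕ)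
    (A : Matrix (Fin r) (Fin r) (PowerSeries ℂ)) :
    ((X : PowerSeries ℂ) ^ (k + 1) • A).map (constantCoeff (R := ℂ)) = 0 := by
  ext i j
  simp

open PowerSeries in
theorem constantCoeff_map_C_map {r : ℕ} (P : Matrix (Fin r) (Fin r) ℂ) :
    (P.map (C (R := ℂ))).map (constantCoeff (R := ℂ)) = P := by
  ext i j
  simp

open PowerSeries in
theorem X_pow_smul_cancel {r : ℕ} (k : ℕ) {A B : Matrix (Fin r) (Fin r) (PowerSeries ℂ)}
    (h : (X : PowerSeries ℂ) ^ k • A = (X : PowerSeries ℂ) ^ k • B) : A = B :=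
  smul_right_injective _ (pow_ne_zero k X_ne_zero) h

/-- Vanishing of the invariant classes descends along a ring map with a retraction. -/
theorem H0H1Vanishes.of_retract {G : Type*} [Group G] {N : Subgroup G} {hN : N.Normal} {r : ℕ}
    {R S : Type*} [CommRing R] [CommRing S] (f : R →+* S) (s : S →+* R)
    (hs : s.comp f = RingHom.id R) (γ : G →* GL (Fin r) R)
    (h : H0H1Vanishes N hN ((Matrix.GeneralLinearGroup.map f).comp γ)) :
    H0H1Vanishes N hN γ := by
  have hval : ∀ g, (((Matrix.GeneralLinearGroup.map f).comp γ) g).val = f.mapMatrix (γ g).val :=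
    fun g => rfl
  have hinv : ∀ g, ((((Matrix.GeneralLinearGroup.map f).comp γ) g)⁻¹).val
      = f.mapMatrix ((γ g)⁻¹).val := fun g => by
    rw [← map_inv, ← map_inv, hval]
  have hsf : ∀ P : Matrix (Fin r) (Fin r) R, s.mapMatrix (f.mapMatrix P) = P := fun P => by
    ext i j
    exact RingHom.congr_fun hs (P i j)
  intro c hc hcoc hinvt
  obtain ⟨m, hm, hcob⟩ := h (fun n => f.mapMatrix (c n)) (fun n => by
      have := congrArg f (hc n)
      simpa [Matrix.trace] using this)
    (fun n n' => by
      simp only [hcoc n n', hval, hinv, map_add, map_mul])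
    (fun g => by
      obtain ⟨m, hm, hmc⟩ := hinvt g
      refine ⟨f.mapMatrix m, ?_, fun n => ?_⟩
      · have := congrArg f hm
        simpa [Matrix.trace] using this
      · have := congrArg f.mapMatrix (hmc n)
        simpa only [hval, hinv, map_sub, map_mul] using this)
  refine ⟨s.mapMatrix m, ?_, fun n => ?_⟩
  · have := congrArg s hm
    simpa [Matrix.trace] using this
  · have := congrArg s.mapMatrix (hcob n)
    simpa only [hval, hinv, map_sub, map_mul, hsf] using this

/-- The commutator of a matrix with a representation is a coboundary, up to removing the trace. -/
theorem isCoboundary_of_matrix {G : Type*} [Group G] (N : Subgroup G) {r : ℕ}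
    (γ : G →* GL (Fin r) ℂ) (c : ↥N → Matrix (Fin r) (Fin r) ℂ) (a : Matrix (Fin r) (Fin r) ℂ)
    (h : ∀ n : ↥N, c n = (γ ↑n).val * a * ((γ ↑n)⁻¹).val - a) : IsCoboundary N γ c := by
  refine ⟨a - (a.trace / r) • 1, ?_, fun n => ?_⟩
  · rcases Nat.eq_zero_or_pos r with rfl | hr
    · simp [Matrix.trace]
    · have : (r : ℂ) ≠ 0 := by exact_mod_cast hr.ne'
      simp [Matrix.trace_sub, Matrix.trace_smul, this]
  · rw [h n]
    simp [mul_sub, sub_mul]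

open PowerSeries in
theorem trace_eq_zero_of_det_eq {r : ℕ} (k : ℕ) (P : GL (Fin r) ℂ)
    (D : Matrix (Fin r) (Fin r) (PowerSeries ℂ))
    (h : (P.val.map (C (R := ℂ)) + (X : PowerSeries ℂ) ^ (k + 1) • D).det = C P.val.det) :
    (D.map (constantCoeff (R := ℂ)) * (P⁻¹).val).trace = 0 := by
  have hP : (P⁻¹).val.map (C (R := ℂ)) * P.val.map (C (R := ℂ)) = 1 := by
    rw [← Matrix.map_mul, P.inv_mul]
    exact map_one (C (R := ℂ)).mapMatrix
  have hfac : P.val.map (C (R := ℂ)) + (X : PowerSeries ℂ) ^ (k + 1) • D =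
      (1 + (X : PowerSeries ℂ) ^ (k + 1) • (D * (P⁻¹).val.map (C (R := ℂ)))) *
        P.val.map (C (R := ℂ)) := by
    rw [add_mul, one_mul, smul_mul_assoc, mul_assoc, hP, mul_one]
  have hdetC : (P.val.map (C (R := ℂ))).det = C P.val.det :=
    ((C (R := ℂ)).map_det P.val).symm
  have hne : C (R := ℂ) P.val.det ≠ 0 := by
    have : P.val.det ≠ 0 := ((Matrix.isUnit_iff_isUnit_det _).1 P.isUnit).ne_zero
    simpa using this
  rw [hfac, Matrix.det_mul, hdetC] at h
  have h1 := mul_right_cancel₀ hne (h.trans (one_mul _).symm)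
  rw [Matrix.det_one_add_smul] at h1
  set T := (D * (P⁻¹).val.map (C (R := ℂ))).trace with hT
  set S := (Matrix.det (1 + (Polynomial.X : Polynomial (PowerSeries ℂ)) •
    (D * (P⁻¹).val.map (C (R := ℂ))).map Polynomial.C)).divX.divX.eval (X ^ (k + 1))
  have h2 : (X : PowerSeries ℂ) ^ (k + 1) * (T + S * X ^ k * X) = 0 := by
    linear_combination h1
  have h3 := (mul_eq_zero.1 h2).resolve_left (pow_ne_zero _ X_ne_zero)
  have h4 : constantCoeff (R := ℂ) T = 0 := by simpa using congrArg (constantCoeff (R := ℂ)) h3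
  have h5 : (D * (P⁻¹).val.map (C (R := ℂ))).map (constantCoeff (R := ℂ)) =
      D.map (constantCoeff (R := ℂ)) * (P⁻¹).val := by
    rw [Matrix.map_mul, constantCoeff_map_C_map]
  rw [← h5, ← h4, hT]
  exact (AddMonoidHom.map_trace (constantCoeff (R := ℂ)).toAddMonoidHom _).symm

open PowerSeries in
/-- The first obstruction to being constant on `N` is the coboundary of a matrix. -/
theorem exists_leadingTerm_eq_commutator {G : Type*} [Group G] (N : Subgroup G) (hN : N.Normal)
    {r : ℕ} (ρ₀ : G →* GL (Fin r) ℂ) (h0 : H0H1Vanishes N hN ρ₀)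
    (ρ : G →* GL (Fin r) (PowerSeries ℂ))
    (hmod : ∀ g : G, ((ρ g).val).map (constantCoeff (R := ℂ)) = (ρ₀ g).val)
    (hdet : ∀ g : G, ((ρ g).val).det = C (R := ℂ) (((ρ₀ g).val).det))
    (k : ℕ) (D : ↥N → Matrix (Fin r) (Fin r) (PowerSeries ℂ))
    (hD : ∀ ν : ↥N, (ρ ↑ν).val =
      (ρ₀ ↑ν).val.map (C (R := ℂ)) + (X : PowerSeries ℂ) ^ (k + 1) • D ν) :
    ∃ m : Matrix (Fin r) (Fin r) ℂ, ∀ ν : ↥N, (D ν).map (constantCoeff (R := ℂ)) =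
      (ρ₀ ↑ν).val * m - m * (ρ₀ ↑ν).val := by
  have hDmul : ∀ ν μ : ↥N, (D (ν * μ)).map (constantCoeff (R := ℂ)) =
      (D ν).map (constantCoeff (R := ℂ)) * (ρ₀ ↑μ).val +
        (ρ₀ ↑ν).val * (D μ).map (constantCoeff (R := ℂ)) := by
    intro ν μ
    have h1 := hD (ν * μ)
    rw [Subgroup.coe_mul, map_mul, map_mul, Units.val_mul, Units.val_mul, hD ν, hD μ,
      Matrix.map_mul] at h1
    have h2 : D (ν * μ) = D ν * (ρ₀ ↑μ).val.map (C (R := ℂ)) +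
        (ρ₀ ↑ν).val.map (C (R := ℂ)) * D μ + (X : PowerSeries ℂ) ^ (k + 1) • (D ν * D μ) := by
      apply X_pow_smul_cancel (k + 1)
      simp only [add_mul, mul_add, smul_mul_assoc, mul_smul_comm, smul_add] at h1 ⊢
      rw [add_assoc] at h1
      rw [← add_left_cancel h1]
      abel
    rw [h2, Matrix.map_add _ (map_add _), Matrix.map_add _ (map_add _), Matrix.map_mul,
      Matrix.map_mul, constantCoeff_map_X_pow_succ_smul, constantCoeff_map_C_map,
      constantCoeff_map_C_map, add_zero]
  obtain ⟨m, -, hm⟩ := h0 (fun ν => (D ν).map (constantCoeff (R := ℂ)) * ((ρ₀ ↑ν)⁻¹).val)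
    (fun ν => trace_eq_zero_of_det_eq k _ _ (by rw [← hD, hdet]))
    (fun ν μ => by
      simp only [hDmul, Subgroup.coe_mul, map_mul, mul_inv_rev, Units.val_mul, add_mul]
      simp only [mul_assoc, Units.mul_inv_cancel_left])
    (fun g => by
      set A := (ρ₀ g)⁻¹.val.map (C (R := ℂ)) * (ρ g).val with hA
      have hgA : (ρ g).val = (ρ₀ g).val.map (C (R := ℂ)) * A := by
        rw [hA, ← mul_assoc, ← Matrix.map_mul, Units.mul_inv,
          Matrix.map_one _ (map_zero _) (map_one _), one_mul]
      have hA0 : A.map (constantCoeff (R := ℂ)) = 1 := by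
        rw [hA, Matrix.map_mul, constantCoeff_map_C_map, hmod, Units.inv_mul]
      apply isCoboundary_of_matrix N ρ₀ _ (-A.map (coeff (k + 1)))
      intro ν
      set μ : ↥N := ⟨g * ↑ν * g⁻¹, hN.conj_mem ↑ν ν.2 g⟩ with hμ
      have hμg : (μ : G) * g = g * ν := by simp [hμ]
      have h1 : (ρ (μ : G)).val * (ρ g).val = (ρ g).val * (ρ ν).val := by
        rw [← Units.val_mul, ← Units.val_mul, ← map_mul, ← map_mul, hμg]
      have h0μ : (ρ₀ g)⁻¹.val * (ρ₀ (μ : G)).val * (ρ₀ g).val = (ρ₀ ν).val := by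
        rw [← Units.val_mul, ← Units.val_mul, ← map_inv, ← map_mul, ← map_mul, mul_assoc, hμg,
          inv_mul_cancel_left]
      have h2 : A * (ρ ν).val = (ρ₀ g)⁻¹.val.map (C (R := ℂ)) * (ρ (μ : G)).val *
          (ρ₀ g).val.map (C (R := ℂ)) * A := by
        rw [mul_assoc _ _ A, ← hgA, hA, mul_assoc, mul_assoc, h1]
      rw [hD, hD, mul_add, mul_add, add_mul, add_mul, ← Matrix.map_mul, ← Matrix.map_mul, h0μ,
        mul_smul_comm, mul_smul_comm, smul_mul_assoc, smul_mul_assoc] at h2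
      have h3 := congrArg (fun B => B.map (coeff (k + 1))) h2
      simp only [Matrix.map_add _ (map_add _), coeff_map_C_map_mul, coeff_map_mul_C_map,
        coeff_map_X_pow_smul, Matrix.map_mul, constantCoeff_map_C_map, hA0, one_mul, mul_one] at h3
      have hinv : ((ρ₀ (μ : G))⁻¹).val * (ρ₀ g).val = (ρ₀ g).val * ((ρ₀ ν)⁻¹).val := by
        rw [← Units.val_mul, ← Units.val_mul, ← map_inv, ← map_inv, ← map_mul, ← map_mul]
        congr 2
        rw [inv_mul_eq_iff_eq_mul, ← mul_assoc, hμg, mul_inv_cancel_right]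
      have h4 := congrArg (fun B => B * ((ρ₀ ν)⁻¹).val) h3
      simp only [add_mul, mul_assoc, Units.mul_inv, mul_one] at h4
      simp only [mul_assoc, hinv, mul_neg, neg_mul]
      rw [eq_sub_of_add_eq' h4]
      abel)
  refine ⟨m, fun ν => ?_⟩
  have := congrArg (fun B => B * (ρ₀ ν).val) (hm ν)
  simpa only [sub_mul, mul_assoc, Units.inv_mul, mul_one] using this

open PowerSeries in
theorem exists_eq_X_pow_smul {r : ℕ} (k : ℕ) (A : Matrix (Fin r) (Fin r) (PowerSeries ℂ))
    (h : ∀ i j, ∀ l < k, coeff l (A i j) = 0) :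
    ∃ D : Matrix (Fin r) (Fin r) (PowerSeries ℂ), A = (X : PowerSeries ℂ) ^ k • D := by
  choose D hD using fun i j => X_pow_dvd_iff.2 (h i j)
  exact ⟨Matrix.of D, Matrix.ext hD⟩

open PowerSeries in
theorem exists_eq_add_X_smul {r : ℕ} (A : Matrix (Fin r) (Fin r) (PowerSeries ℂ))
    (B : Matrix (Fin r) (Fin r) ℂ) (h : A.map (constantCoeff (R := ℂ)) = B) :
    ∃ D : Matrix (Fin r) (Fin r) (PowerSeries ℂ),
      A = B.map (C (R := ℂ)) + (X : PowerSeries ℂ) • D := by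
  obtain ⟨D, hD⟩ := exists_eq_X_pow_smul 1 (A - B.map (C (R := ℂ))) (by
    intro i j l hl
    obtain rfl : l = 0 := by omega
    simp [← h])
  exact ⟨D, by rw [← pow_one (X : PowerSeries ℂ), ← hD]; abel⟩

open PowerSeries in
theorem exists_unit_of_constantCoeff_eq_one {r : ℕ} (A : Matrix (Fin r) (Fin r) (PowerSeries ℂ))
    (h : A.map (constantCoeff (R := ℂ)) = 1) : ∃ U : GL (Fin r) (PowerSeries ℂ), U.val = A := by
  have : IsUnit A := by
    rw [Matrix.isUnit_iff_isUnit_det, isUnit_iff_constantCoeff, RingHom.map_det,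
      RingHom.mapMatrix_apply, h, Matrix.det_one]
    exact isUnit_one
  exact this

open PowerSeries in
/-- `M` conjugates the restriction of `ρ` to `N` into `ρ₀` modulo `t ^ (n + 1)`. -/
def ConjugatesModulo {G : Type*} [Group G] (N : Subgroup G) {r : ℕ} (ρ₀ : G →* GL (Fin r) ℂ)
    (ρ : G →* GL (Fin r) (PowerSeries ℂ)) (n : ℕ) (M : GL (Fin r) (PowerSeries ℂ)) : Prop :=
  M.val.map (constantCoeff (R := ℂ)) = 1 ∧
    ∀ ν : ↥N, ∃ D : Matrix (Fin r) (Fin r) (PowerSeries ℂ),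
      (M * ρ ↑ν * M⁻¹).val =
        (ρ₀ ↑ν).val.map (C (R := ℂ)) + (X : PowerSeries ℂ) ^ (n + 1) • D

open PowerSeries in
theorem ConjugatesModulo.exists_succ {G : Type*} [Group G] {N : Subgroup G} {hN : N.Normal}
    {r : ℕ} {ρ₀ : G →* GL (Fin r) ℂ} (h0 : H0H1Vanishes N hN ρ₀)
    {ρ : G →* GL (Fin r) (PowerSeries ℂ)}
    (hmod : ∀ g : G, ((ρ g).val).map (constantCoeff (R := ℂ)) = (ρ₀ g).val)
    (hdet : ∀ g : G, ((ρ g).val).det = C (R := ℂ) (((ρ₀ g).val).det))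
    {n : ℕ} {M : GL (Fin r) (PowerSeries ℂ)} (hM : ConjugatesModulo N ρ₀ ρ n M) :
    ∃ M' : GL (Fin r) (PowerSeries ℂ), ConjugatesModulo N ρ₀ ρ (n + 1) M' ∧
      ∃ E : Matrix (Fin r) (Fin r) (PowerSeries ℂ),
        M'.val = M.val + (X : PowerSeries ℂ) ^ (n + 1) • E := by
  obtain ⟨hM1, hMD⟩ := hM
  choose D hD using hMD
  have hMinv : (M⁻¹).val.map (constantCoeff (R := ℂ)) = 1 := by
    have h := congrArg (fun B => B.map (constantCoeff (R := ℂ))) M.mul_inv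
    simpa only [Matrix.map_mul, hM1, one_mul, Matrix.map_one _ (map_zero _) (map_one _)] using h
  obtain ⟨m, hm⟩ := exists_leadingTerm_eq_commutator N hN ρ₀ h0
    ((MulAut.conj M).toMonoidHom.comp ρ)
    (fun g => by
      change (M.val * (ρ g).val * (M⁻¹).val).map (constantCoeff (R := ℂ)) = _
      rw [Matrix.map_mul, Matrix.map_mul, hM1, hMinv, hmod, one_mul, mul_one])
    (fun g => by
      change (M.val * (ρ g).val * (M⁻¹).val).det = _
      rw [Matrix.det_mul_right_comm, M.mul_inv, one_mul, hdet])
    n D hD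
  obtain ⟨U, hU⟩ := exists_unit_of_constantCoeff_eq_one
    (1 + (X : PowerSeries ℂ) ^ (n + 1) • m.map (C (R := ℂ))) (by
      rw [Matrix.map_add _ (map_add _), constantCoeff_map_X_pow_succ_smul,
        Matrix.map_one _ (map_zero _) (map_one _), add_zero])
  refine ⟨U * M, ⟨?_, fun ν => ?_⟩, m.map (C (R := ℂ)) * M.val, ?_⟩
  · rw [Units.val_mul, Matrix.map_mul, hM1, hU, Matrix.map_add _ (map_add _),
      constantCoeff_map_X_pow_succ_smul, Matrix.map_one _ (map_zero _) (map_one _), add_zero,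
      one_mul]
  · obtain ⟨F, hF⟩ := exists_eq_add_X_smul (D ν) _ (hm ν)
    have h1 : U.val * (M * ρ ↑ν * M⁻¹).val = (ρ₀ ↑ν).val.map (C (R := ℂ)) * U.val +
        (X : PowerSeries ℂ) ^ (n + 1 + 1) •
          (F + (X : PowerSeries ℂ) ^ n • (m.map (C (R := ℂ)) * D ν)) := by
      have h2 : (X : PowerSeries ℂ) ^ (n + 1) • D ν = (X : PowerSeries ℂ) ^ (n + 1) •
          ((ρ₀ ↑ν).val.map (C (R := ℂ)) * m.map (C (R := ℂ)) -
            m.map (C (R := ℂ)) * (ρ₀ ↑ν).val.map (C (R := ℂ))) +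
          (X : PowerSeries ℂ) ^ (n + 1 + 1) • F := by
        conv_lhs => rw [hF]
        rw [smul_add, smul_smul, ← pow_succ, Matrix.map_sub _ (map_sub _), Matrix.map_mul,
          Matrix.map_mul]
      rw [hD, hU, add_mul, one_mul, mul_add, mul_add, mul_one]
      conv_lhs =>
        enter [1, 2]
        rw [h2]
      simp only [smul_mul_assoc, mul_smul_comm, smul_add, smul_smul, smul_sub, ← pow_add]
      rw [show n + 1 + 1 + n = n + 1 + (n + 1) by ring]
      abel
    refine ⟨(F + (X : PowerSeries ℂ) ^ n • (m.map (C (R := ℂ)) * D ν)) * (U⁻¹).val, ?_⟩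
    have h3 := congrArg (fun B => B * (U⁻¹).val) h1
    simp only [add_mul, mul_assoc, Units.mul_inv, mul_one, smul_mul_assoc] at h3
    simp only [mul_inv_rev, Units.val_mul, mul_assoc, add_mul, smul_mul_assoc] at h3 ⊢
    exact h3
  · rw [Units.val_mul, hU, add_mul, one_mul, smul_mul_assoc]

open PowerSeries in
/-- A `t`-adically convergent sequence of matrices has a limit. -/
theorem exists_tadic_limit {r : ℕ} (M : ℕ → Matrix (Fin r) (Fin r) (PowerSeries ℂ))
    (h : ∀ n, ∃ E : Matrix (Fin r) (Fin r) (PowerSeries ℂ),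
      M (n + 1) = M n + (X : PowerSeries ℂ) ^ (n + 1) • E) :
    ∃ L : Matrix (Fin r) (Fin r) (PowerSeries ℂ), ∀ n,
      ∃ E : Matrix (Fin r) (Fin r) (PowerSeries ℂ),
        L = M n + (X : PowerSeries ℂ) ^ (n + 1) • E := by
  have hstab : ∀ i j l d, coeff l (M (l + d) i j) = coeff l (M l i j) := by
    intro i j l d
    induction d with
    | zero => rfl
    | succ d ih =>
      obtain ⟨E, hE⟩ := h (l + d)
      rw [← ih, ← add_assoc, hE]
      simp [coeff_X_pow_mul', show ¬ l + d + 1 ≤ l by omega]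
  let L : Matrix (Fin r) (Fin r) (PowerSeries ℂ) :=
    Matrix.of fun i j => PowerSeries.mk fun l => coeff l (M l i j)
  refine ⟨L, fun n => ?_⟩
  obtain ⟨E, hE⟩ := exists_eq_X_pow_smul (n + 1) (L - M n) (by
    intro i j l hl
    obtain ⟨d, rfl⟩ := Nat.exists_eq_add_of_le (Nat.lt_succ_iff.1 hl)
    simp [L, hstab])
  exact ⟨E, by rw [← hE]; abel⟩

open PowerSeries in
theorem eq_of_forall_eq_add_X_pow_smul {r : ℕ} {A B : Matrix (Fin r) (Fin r) (PowerSeries ℂ)}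
    (h : ∀ n : ℕ, ∃ E : Matrix (Fin r) (Fin r) (PowerSeries ℂ),
      A = B + (X : PowerSeries ℂ) ^ (n + 1) • E) : A = B := by
  ext i j l
  obtain ⟨E, hE⟩ := h l
  rw [hE]
  simp [coeff_X_pow_mul']

/-- Let `N ⊴ G` and `ρ₀ : G →* GL_r(ℂ)`.  Suppose that for all `n` and all deformations
`γ : G →* GL_r(B_n)` of `ρ₀` with `γ|_N` constant one has `H⁰(Q, H¹(N, ad γ|_N)) = 0`.
Then for every `ρ_∞ : G →* GL_r(ℂ[[t]])` lifting `ρ₀` with constant determinant, the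
restriction `ρ_∞|_N` is conjugate to a constant representation. -/
theorem formal_deformation_conjugate_to_constant_on_normal_subgroup
    {G : Type*} [Group G] (N : Subgroup G) (hN : N.Normal) {r : ℕ}
    (ρ₀ : G →* GL (Fin r) ℂ)
    (hvan : ∀ n : ℕ, ∀ γ : G →* GL (Fin r) (Bn n),
      (∀ g : G, ((γ g).val).map (BnToC n) = (ρ₀ g).val) →
      (∀ ν : ↥N, ∃ Q : Matrix (Fin r) (Fin r) ℂ,
        (γ ↑ν).val = Q.map (algebraMap ℂ (Bn n))) →
      H0H1Vanishes N hN γ)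
    (ρ₁ : G →* GL (Fin r) (PowerSeries ℂ))
    (hmod : ∀ g : G, ((ρ₁ g).val).map (PowerSeries.constantCoeff (R := ℂ)) = (ρ₀ g).val)
    (hdet : ∀ g : G, ((ρ₁ g).val).det = PowerSeries.C (R := ℂ) (((ρ₀ g).val).det)) :
    ∃ M : GL (Fin r) (PowerSeries ℂ), ∀ ν : ↥N,
      ∃ Q : Matrix (Fin r) (Fin r) ℂ,
        (M * ρ₁ ↑ν * M⁻¹).val = Q.map (PowerSeries.C (R := ℂ)) := by
  have h0 : H0H1Vanishes N hN ρ₀ := by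
    have hs : (BnToC 0).comp (algebraMap ℂ (Bn 0)) = RingHom.id ℂ := by
      ext z
      change BnToC 0 (Ideal.Quotient.mk _ (Polynomial.C z)) = z
      simp [BnToC]
    refine H0H1Vanishes.of_retract (algebraMap ℂ (Bn 0)) (BnToC 0) hs ρ₀
      (hvan 0 _ (fun g => ?_) fun ν => ⟨(ρ₀ ↑ν).val, rfl⟩)
    ext i j
    exact RingHom.congr_fun hs ((ρ₀ g).val i j)
  have hbase : ConjugatesModulo N ρ₀ ρ₁ 0 1 := by
    refine ⟨Matrix.map_one _ (map_zero _) (map_one _), fun ν => ?_⟩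
    obtain ⟨D, hD⟩ := exists_eq_add_X_smul _ _ (hmod ν)
    exact ⟨D, by simpa using hD⟩
  choose next hnext using fun (n : ℕ) (M : {M // ConjugatesModulo N ρ₀ ρ₁ n M}) =>
    ConjugatesModulo.exists_succ h0 hmod hdet M.2
  let S : ∀ n, {M // ConjugatesModulo N ρ₀ ρ₁ n M} := fun n =>
    Nat.rec ⟨1, hbase⟩ (fun n M => ⟨next n M, (hnext n M).1⟩) n
  obtain ⟨L, hL⟩ := exists_tadic_limit (fun n => (S n).1.val) fun n => (hnext n (S n)).2
  obtain ⟨M, hM⟩ := exists_unit_of_constantCoeff_eq_one L (by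
    obtain ⟨E, hE⟩ := hL 0
    rw [hE, Matrix.map_add _ (map_add _), constantCoeff_map_X_pow_succ_smul, (S 0).2.1, add_zero])
  refine ⟨M, fun ν => ⟨(ρ₀ ↑ν).val, ?_⟩⟩
  have key : L * (ρ₁ ↑ν).val = (ρ₀ ↑ν).val.map (PowerSeries.C (R := ℂ)) * L := by
    refine eq_of_forall_eq_add_X_pow_smul fun n => ?_
    obtain ⟨E, hE⟩ := hL n
    obtain ⟨D, hD⟩ := (S n).2.2 ν
    have h1 := congrArg (fun B => B * (S n).1.val) hD
    simp only [Units.val_mul, mul_assoc, Units.inv_mul, mul_one, add_mul] at h1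
    refine ⟨D * (S n).1.val + E * (ρ₁ ↑ν).val -
      (ρ₀ ↑ν).val.map (PowerSeries.C (R := ℂ)) * E, ?_⟩
    rw [hE, add_mul, h1, mul_add]
    simp only [smul_add, smul_sub, smul_mul_assoc, mul_smul_comm]
    abel
  rw [Units.val_mul, Units.val_mul, hM, key, ← hM, mul_assoc, Units.mul_inv, mul_one]
end

section
/- Let g ≥ 1 and let π_g be the genus-g surface group with generators x₁, …, x_{2g} (where x₁, …, x_{2g} is the list a₁, b₁, …, a_g, b_g). There exists a group homomorphism ρ : π_g → GL_{2g+1}(ℂ) sending x_i to the elementary unipotent matrix I + E_{i,2g+1} (identity plus the matrix with a single 1 in row i, column 2g+1) for each 1 ≤ i ≤ 2g; moreover any such ρ has infinite image, and its conjugacy class is fixed by every automorphism of π_g: for each φ ∈ Aut(π_g) there exists B ∈ GL_{2g+1}(ℂ) with ρ(φ(w)) = B ρ(w) B⁻¹ for all w ∈ π_g. In particular, for every g ≥ 1 there is an MCG-finite representation of π_g of rank 2g+1 with infinite image, so the bound √(g+1) in the paper's main theorem cannot be improved beyond a bound linear in g. -/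
open scoped commutatorElement

/-- The row index in `Fin (2g+1)` attached to the generator `x` of `π_g` indexed by
`p : Fin g × Bool`: the generators `a₁, b₁, …, a_g, b_g` correspond to rows
`0, 1, …, 2g-2, 2g-1`. -/
def genRow (g : ℕ) (p : Fin g × Bool) : Fin (2 * g + 1) :=
  ⟨2 * p.1.val + (if p.2 then 1 else 0), by have := p.1.isLt; split <;> omega⟩

/-- The last index `2g` in `Fin (2g+1)` (the column of the nontrivial entries). -/
def lastCol (g : ℕ) : Fin (2 * g + 1) := ⟨2 * g, by omega⟩

/-- `ρ` sends each generator `xᵢ` of `π_g` to the elementary unipotent matrix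
`I + E_{i, 2g+1}`. -/
def SendsGeneratorsToElementaries (g : ℕ)
    (ρ : SurfaceGroup g →* GL (Fin (2 * g + 1)) ℂ) : Prop :=
  ∀ p : Fin g × Bool,
    ((ρ (PresentedGroup.of p) : GL (Fin (2 * g + 1)) ℂ) :
        Matrix (Fin (2 * g + 1)) (Fin (2 * g + 1)) ℂ)
      = 1 + Matrix.single (genRow g p) (lastCol g) 1

/-- The abelianization of `π_g`, with values in the complex vector space on its generators. -/
noncomputable def surfaceAb (g : ℕ) :
    SurfaceGroup g →* Multiplicative (Fin g × Bool → ℂ) :=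
  PresentedGroup.toGroup (f := fun p => Multiplicative.ofAdd (Pi.single p 1)) <| by
    rintro r rfl
    have h (v w : Multiplicative (Fin g × Bool → ℂ)) : ⁅v, w⁆ = 1 :=
      commutatorElement_eq_one_iff_mul_comm.2 (mul_comm v w)
    simp [map_list_prod, Function.comp_def, map_commutatorElement, h]

@[simp]
theorem surfaceAb_of (g : ℕ) (p : Fin g × Bool) :
    surfaceAb g (PresentedGroup.of p) = Multiplicative.ofAdd (Pi.single p 1) :=
  PresentedGroup.toGroup.of _

/-- The matrix of the action of an endomorphism of `π_g` on the complexified abelianization. -/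
noncomputable def surfaceAbMatrix {g : ℕ} (φ : SurfaceGroup g →* SurfaceGroup g) :
    Matrix (Fin g × Bool) (Fin g × Bool) ℂ :=
  Matrix.of fun p q => (surfaceAb g (φ (PresentedGroup.of q))).toAdd p

theorem surfaceAb_apply_endomorphism {g : ℕ} (φ : SurfaceGroup g →* SurfaceGroup g)
    (w : SurfaceGroup g) :
    (surfaceAb g (φ w)).toAdd = (surfaceAbMatrix φ).mulVec (surfaceAb g w).toAdd := by
  have h : (surfaceAb g).comp φ =
      (AddMonoidHom.toMultiplicative (surfaceAbMatrix φ).mulVecLin.toAddMonoidHom).comp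
        (surfaceAb g) := by
    refine PresentedGroup.ext fun p => ?_
    apply Multiplicative.toAdd.injective
    ext i
    simp [surfaceAbMatrix]
  exact congrArg Multiplicative.toAdd (DFunLike.congr_fun h w)

theorem surfaceAbMatrix_mul_of_leftInverse {g : ℕ} {φ ψ : SurfaceGroup g →* SurfaceGroup g}
    (h : Function.LeftInverse ψ φ) : surfaceAbMatrix ψ * surfaceAbMatrix φ = 1 := by
  refine Matrix.ext_of_mulVec_single fun q => ?_
  have hφ := surfaceAb_apply_endomorphism φ (PresentedGroup.of q)
  have hψ := surfaceAb_apply_endomorphism ψ (φ (PresentedGroup.of q))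
  rw [h, hφ, surfaceAb_of, toAdd_ofAdd, Matrix.mulVec_mulVec] at hψ
  rw [← hψ, Matrix.one_mulVec]

/-- The unipotent block matrix with a column vector in its upper right corner. -/
def unipotentColumn (ι R : Type*) [Fintype ι] [DecidableEq ι] [CommRing R] :
    Multiplicative (ι → R) →* Matrix (ι ⊕ Unit) (ι ⊕ Unit) R where
  toFun v := Matrix.fromBlocks 1 (Matrix.replicateCol Unit v.toAdd) 0 1
  map_one' := by simp
  map_mul' v w := by simp [Matrix.fromBlocks_multiply, add_comm]

theorem unipotentColumn_apply {ι R : Type*} [Fintype ι] [DecidableEq ι] [CommRing R]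
    (v : Multiplicative (ι → R)) :
    unipotentColumn ι R v = Matrix.fromBlocks 1 (Matrix.replicateCol Unit v.toAdd) 0 1 := rfl

theorem unipotentColumn_injective (ι R : Type*) [Fintype ι] [DecidableEq ι] [CommRing R] :
    Function.Injective (unipotentColumn ι R) := by
  intro v w h
  rw [unipotentColumn_apply, unipotentColumn_apply, Matrix.fromBlocks_inj] at h
  exact Multiplicative.toAdd.injective (Matrix.replicateCol_injective h.2.1)

theorem genRow_injective (g : ℕ) : Function.Injective (genRow g) := by
  rintro ⟨i, a⟩ ⟨j, b⟩ h
  simp only [genRow, Fin.mk.injEq] at h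
  cases a <;> cases b <;> simp_all [Fin.ext_iff] <;> omega

theorem genRow_ne_lastCol (g : ℕ) (p : Fin g × Bool) : genRow g p ≠ lastCol g := by
  have := p.1.isLt
  simp only [genRow, lastCol, ne_eq, Fin.mk.injEq]
  split <;> omega

/-- The matrix indices of `GL (2g+1)` are the generators of `π_g` and the last column. -/
noncomputable def rowEquiv (g : ℕ) : (Fin g × Bool) ⊕ Unit ≃ Fin (2 * g + 1) :=
  Equiv.ofBijective (Sum.elim (genRow g) fun _ => lastCol g) <| by
    rw [Fintype.bijective_iff_injective_and_card]
    refine ⟨(genRow_injective g).sumElim (Function.injective_of_subsingleton _)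
      fun p _ => genRow_ne_lastCol g p, ?_⟩
    simp [mul_comm]

@[simp]
theorem rowEquiv_inl (g : ℕ) (p : Fin g × Bool) : rowEquiv g (Sum.inl p) = genRow g p := rfl

@[simp]
theorem rowEquiv_inr (g : ℕ) (u : Unit) : rowEquiv g (Sum.inr u) = lastCol g := rfl

/-- The unipotent representation of `π_g` of rank `2g+1`. -/
noncomputable def surfaceUnipotentRep (g : ℕ) : SurfaceGroup g →* GL (Fin (2 * g + 1)) ℂ :=
  (((Matrix.reindexAlgEquiv ℂ ℂ (rowEquiv g) : _ →* _).comp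
    (unipotentColumn (Fin g × Bool) ℂ)).comp (surfaceAb g)).toHomUnits

theorem coe_surfaceUnipotentRep (g : ℕ) (w : SurfaceGroup g) :
    (surfaceUnipotentRep g w : Matrix (Fin (2 * g + 1)) (Fin (2 * g + 1)) ℂ) =
      Matrix.reindexAlgEquiv ℂ ℂ (rowEquiv g) (unipotentColumn _ ℂ (surfaceAb g w)) := rfl

theorem surfaceUnipotentRep_sendsGeneratorsToElementaries (g : ℕ) :
    SendsGeneratorsToElementaries g (surfaceUnipotentRep g) := by
  intro p
  rw [coe_surfaceUnipotentRep, ← AlgEquiv.eq_symm_apply]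
  ext i j
  rcases i with i | i <;> rcases j with j | j <;>
    simp [unipotentColumn_apply, Matrix.one_apply, Matrix.single_apply,
      (genRow_injective g).eq_iff, genRow_ne_lastCol, (genRow_ne_lastCol _ _).symm,
      Pi.single_apply, eq_comm]

theorem SendsGeneratorsToElementaries.eq_surfaceUnipotentRep {g : ℕ}
    {ρ : SurfaceGroup g →* GL (Fin (2 * g + 1)) ℂ} (h : SendsGeneratorsToElementaries g ρ) :
    ρ = surfaceUnipotentRep g :=
  PresentedGroup.ext fun p =>
    Units.ext ((h p).trans (surfaceUnipotentRep_sendsGeneratorsToElementaries g p).symm)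

theorem infinite_range_surfaceUnipotentRep {g : ℕ} (hg : 1 ≤ g) :
    (Set.range (surfaceUnipotentRep g)).Infinite := by
  let p : Fin g × Bool := (⟨0, hg⟩, false)
  refine Set.infinite_of_injective_forall_mem
    (f := fun n : ℕ => surfaceUnipotentRep g (PresentedGroup.of p ^ n)) ?_ fun n => ⟨_, rfl⟩
  intro m n h
  have h' := unipotentColumn_injective _ _
    ((Matrix.reindexAlgEquiv ℂ ℂ (rowEquiv g)).injective (congrArg Units.val h))
  simpa using congrFun (congrArg Multiplicative.toAdd h') p

theorem exists_conj_surfaceUnipotentRep {g : ℕ} (φ : MulAut (SurfaceGroup g)) :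
    ∃ B : GL (Fin (2 * g + 1)) ℂ, ∀ w : SurfaceGroup g,
      surfaceUnipotentRep g (φ w) = B * surfaceUnipotentRep g w * B⁻¹ := by
  let α : SurfaceGroup g →* SurfaceGroup g := MulEquiv.toMonoidHom φ
  let β : SurfaceGroup g →* SurfaceGroup g := (MulEquiv.symm φ).toMonoidHom
  have h₁ : surfaceAbMatrix β * surfaceAbMatrix α = 1 :=
    surfaceAbMatrix_mul_of_leftInverse φ.left_inv
  have h₂ : surfaceAbMatrix α * surfaceAbMatrix β = 1 :=
    surfaceAbMatrix_mul_of_leftInverse φ.right_inv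
  let B : GL ((Fin g × Bool) ⊕ Unit) ℂ :=
    ⟨Matrix.fromBlocks (surfaceAbMatrix α) 0 0 1, Matrix.fromBlocks (surfaceAbMatrix β) 0 0 1,
      by simp [Matrix.fromBlocks_multiply, h₂], by simp [Matrix.fromBlocks_multiply, h₁]⟩
  refine ⟨Units.map (Matrix.reindexAlgEquiv ℂ ℂ (rowEquiv g) : _ →* _) B, fun w => ?_⟩
  rw [eq_mul_inv_iff_mul_eq]
  ext1
  have h : unipotentColumn _ ℂ (surfaceAb g (φ w)) * B.val =
      B.val * unipotentColumn _ ℂ (surfaceAb g w) := by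
    have hφ : (surfaceAb g (φ w)).toAdd = _ := surfaceAb_apply_endomorphism α w
    simp [B, unipotentColumn_apply, Matrix.fromBlocks_multiply, hφ, Matrix.replicateCol_mulVec]
  simpa only [map_mul, Units.val_mul, coe_surfaceUnipotentRep, Units.coe_map,
    MonoidHom.coe_coe] using congrArg (Matrix.reindexAlgEquiv ℂ ℂ (rowEquiv g)) h

/-- For every `g ≥ 1` there is a homomorphism `ρ : π_g →* GL_{2g+1}(ℂ)` sending the
generator `xᵢ` to `I + E_{i,2g+1}`; any such `ρ` has infinite image and its conjugacy
class is fixed by every automorphism of `π_g`. -/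
theorem surface_group_unipotent_example (g : ℕ) (hg : 1 ≤ g) :
    (∃ ρ : SurfaceGroup g →* GL (Fin (2 * g + 1)) ℂ,
      SendsGeneratorsToElementaries g ρ) ∧
    ∀ ρ : SurfaceGroup g →* GL (Fin (2 * g + 1)) ℂ,
      SendsGeneratorsToElementaries g ρ →
        Set.Infinite (Set.range ⇑ρ) ∧
        ∀ φ : MulAut (SurfaceGroup g), ∃ B : GL (Fin (2 * g + 1)) ℂ,
          ∀ w : SurfaceGroup g, ρ (φ w) = B * ρ w * B⁻¹ := by
  refine ⟨⟨_, surfaceUnipotentRep_sendsGeneratorsToElementaries g⟩, fun ρ hρ => ?_⟩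
  rw [hρ.eq_surfaceUnipotentRep]
  exact ⟨infinite_range_surfaceUnipotentRep hg, exists_conj_surfaceUnipotentRep⟩
end

section
/- Let g = 2 or g = 3. Every representation ρ : π_g → GL₂(ℂ) of the genus-g surface group which has finite orbit under Aut(π_g) (equivalently, is MCG-finite) has finite image. (Thus the bound r < √(g+1) of the paper's main theorem is not sharp for g = 2, 3, since it only covers r = 1 there.) -/
open scoped commutatorElement

namespace SurfaceGroup

variable {g : ℕ}

/-- The generator `aᵢ` of the surface group. -/
noncomputable def a (i : Fin g) : SurfaceGroup g := PresentedGroup.of (i, false)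

/-- The generator `bᵢ` of the surface group. -/
noncomputable def b (i : Fin g) : SurfaceGroup g := PresentedGroup.of (i, true)

/-- The homomorphism out of the surface group given by images of the generators. -/
noncomputable def lift {G : Type*} [Group G] (u v : Fin g → G)
    (h : ((List.finRange g).map fun i => ⁅u i, v i⁆).prod = 1) : SurfaceGroup g →* G :=
  PresentedGroup.toGroup (f := fun p => if p.2 then v p.1 else u p.1) <| by
    rintro r rfl
    simpa [surfaceRelator, map_list_prod, Function.comp_def, map_commutatorElement] using h

@[simp] lemma lift_a {G : Type*} [Group G] (u v : Fin g → G) (h) (i : Fin g) :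
    lift u v h (a i) = u i := by
  simp [lift, a]

@[simp] lemma lift_b {G : Type*} [Group G] (u v : Fin g → G) (h) (i : Fin g) :
    lift u v h (b i) = v i := by
  simp [lift, b]

lemma hom_ext {G : Type*} [Group G] {f f' : SurfaceGroup g →* G}
    (ha : ∀ i, f (a i) = f' (a i)) (hb : ∀ i, f (b i) = f' (b i)) : f = f' := by
  refine PresentedGroup.ext ?_
  rintro ⟨i, _ | _⟩
  · exact ha i
  · exact hb i

lemma relation : ((List.finRange g).map fun i => ⁅a i, b i⁆).prod = (1 : SurfaceGroup g) := by
  have h : PresentedGroup.mk {surfaceRelator g} (surfaceRelator g) = 1 :=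
    PresentedGroup.one_of_mem rfl
  simp only [map_list_prod, List.map_map, Function.comp_def, map_commutatorElement] at h
  exact h

lemma closure_generators : Subgroup.closure (Set.range (a (g := g)) ∪ Set.range b) = ⊤ := by
  rw [← top_le_iff, ← PresentedGroup.closure_range_of, Subgroup.closure_le]
  rintro _ ⟨⟨i, _ | _⟩, rfl⟩
  · exact Subgroup.subset_closure (Or.inl ⟨i, rfl⟩)
  · exact Subgroup.subset_closure (Or.inr ⟨i, rfl⟩)

lemma exists_aut (u v u' v' : Fin g → SurfaceGroup g)
    (h : ((List.finRange g).map fun i => ⁅u i, v i⁆).prod = 1)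
    (h' : ((List.finRange g).map fun i => ⁅u' i, v' i⁆).prod = 1)
    (hu : ∀ i, lift u' v' h' (u i) = a i) (hv : ∀ i, lift u' v' h' (v i) = b i)
    (hu' : ∀ i, lift u v h (u' i) = a i) (hv' : ∀ i, lift u v h (v' i) = b i) :
    ∃ φ : MulAut (SurfaceGroup g), ∀ i, φ (a i) = u i ∧ φ (b i) = v i :=
  ⟨MonoidHom.toMulEquiv (lift u v h) (lift u' v' h')
    (hom_ext (by simpa using hu) (by simpa using hv))
    (hom_ext (by simpa using hu') (by simpa using hv')), by simp⟩

lemma prod_commutator_update {G : Type*} [Group G] (u v : Fin g → G) (i : Fin g) (x y : G)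
    (h : ⁅x, y⁆ = ⁅u i, v i⁆) :
    ((List.finRange g).map fun j => ⁅Function.update u i x j, Function.update v i y j⁆).prod =
      ((List.finRange g).map fun j => ⁅u j, v j⁆).prod := by
  congr 2
  funext j
  rcases eq_or_ne j i with rfl | hj
  · simpa using h
  · simp [hj]

/-- The Dehn twist along `aᵢ`. -/
lemma exists_twist (i : Fin g) : ∃ φ : MulAut (SurfaceGroup g),
    φ (a i) = a i ∧ φ (b i) = b i * a i ∧ ∀ j, j ≠ i → φ (a j) = a j ∧ φ (b j) = b j := by
  obtain ⟨φ, hφ⟩ := exists_aut (Function.update a i (a i)) (Function.update b i (b i * a i))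
    (Function.update a i (a i)) (Function.update b i (b i * (a i)⁻¹))
    ((prod_commutator_update a b i _ _ (by simp only [commutatorElement_def]; group)).trans
      relation)
    ((prod_commutator_update a b i _ _ (by simp only [commutatorElement_def]; group)).trans
      relation)
    (fun j => by rcases eq_or_ne j i with rfl | hj <;> simp [*])
    (fun j => by rcases eq_or_ne j i with rfl | hj <;> simp [*])
    (fun j => by rcases eq_or_ne j i with rfl | hj <;> simp [*])
    (fun j => by rcases eq_or_ne j i with rfl | hj <;> simp [*])
  exact ⟨φ, by simp [hφ], by simp [hφ], fun j hj => by simp [hφ, hj]⟩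

/-- The quarter rotation of the `i`-th handle. -/
lemma exists_rotation (i : Fin g) : ∃ φ : MulAut (SurfaceGroup g),
    φ (a i) = (b i)⁻¹ ∧ φ (b i) = b i * a i * (b i)⁻¹ ∧
      ∀ j, j ≠ i → φ (a j) = a j ∧ φ (b j) = b j := by
  obtain ⟨φ, hφ⟩ := exists_aut (Function.update a i (b i)⁻¹)
    (Function.update b i (b i * a i * (b i)⁻¹))
    (Function.update a i (a i * b i * (a i)⁻¹)) (Function.update b i (a i)⁻¹)
    ((prod_commutator_update a b i _ _ (by simp only [commutatorElement_def]; group)).trans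
      relation)
    ((prod_commutator_update a b i _ _ (by simp only [commutatorElement_def]; group)).trans
      relation)
    (fun j => by rcases eq_or_ne j i with rfl | hj <;> simp [*])
    (fun j => by rcases eq_or_ne j i with rfl | hj <;> simp [*, mul_assoc])
    (fun j => by rcases eq_or_ne j i with rfl | hj <;> simp [*, mul_assoc])
    (fun j => by rcases eq_or_ne j i with rfl | hj <;> simp [*])
  exact ⟨φ, by simp [hφ], by simp [hφ], fun j hj => by simp [hφ, hj]⟩

lemma exists_finRange_split (i : Fin g) : ∃ l₁ l₂ : List (Fin g),
    List.finRange g = l₁ ++ i :: l₂ ∧ (∀ k ∈ l₁, k < i) ∧ ∀ k ∈ l₂, i < k := by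
  obtain ⟨l₁, l₂, h⟩ := List.append_of_mem (List.mem_finRange i)
  have hs : (List.finRange g).Pairwise (· < ·) := List.pairwise_lt_finRange g
  rw [h, List.pairwise_append, List.pairwise_cons] at hs
  exact ⟨l₁, l₂, h, fun k hk => hs.2.2 k hk i (by simp), hs.2.1.1⟩

lemma exists_finRange_split₂ {i j : Fin g} (hij : i < j) : ∃ l₁ l₂ l₃ : List (Fin g),
    List.finRange g = l₁ ++ i :: (l₂ ++ j :: l₃) ∧ (∀ k ∈ l₁, k < i) ∧
      (∀ k ∈ l₂, i < k ∧ k < j) ∧ ∀ k ∈ l₃, j < k := by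
  obtain ⟨l₁, l, h, h₁, h₂⟩ := exists_finRange_split i
  have hj : j ∈ l := by
    have := List.mem_finRange j
    rw [h] at this
    simp only [List.mem_append, List.mem_cons] at this
    rcases this with hj | rfl | hj
    · exact absurd (h₁ j hj) hij.asymm
    · exact absurd hij (lt_irrefl _)
    · exact hj
  obtain ⟨l₂, l₃, rfl⟩ := List.append_of_mem hj
  have hs : (List.finRange g).Pairwise (· < ·) := List.pairwise_lt_finRange g
  rw [h, List.pairwise_append, List.pairwise_cons, List.pairwise_append, List.pairwise_cons] at hs
  exact ⟨l₁, l₂, l₃, h, h₁, fun k hk => ⟨h₂ k (by simp [hk]), hs.2.1.2.2.2 k hk j (by simp)⟩,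
    hs.2.1.2.2.1.1⟩

/-- The simple closed curve surrounding one side of `aᵢ` and of `aⱼ`. -/
noncomputable def curve (i j : Fin g) : SurfaceGroup g := b i * (a i)⁻¹ * (b i)⁻¹ * a j

/-- Images of the `aₖ` under the power `w` of the Dehn twist along `curve i j`. -/
noncomputable def curveTwistA (i j : Fin g) (w : SurfaceGroup g) (k : Fin g) : SurfaceGroup g :=
  if k = j then w * a j * w⁻¹
  else if i < k ∧ k < j then ⁅w, a j⁆ * a k * ⁅w, a j⁆⁻¹ else a k

/-- Images of the `bₖ` under the power `w` of the Dehn twist along `curve i j`. -/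
noncomputable def curveTwistB (i j : Fin g) (w : SurfaceGroup g) (k : Fin g) : SurfaceGroup g :=
  if k = i then w * b i else if k = j then b j * w⁻¹
  else if i < k ∧ k < j then ⁅w, a j⁆ * b k * ⁅w, a j⁆⁻¹ else b k

lemma curveTwist_relation {i j : Fin g} (hij : i < j) (w : SurfaceGroup g)
    (hw : Commute w (curve i j)) :
    ((List.finRange g).map fun k => ⁅curveTwistA i j w k, curveTwistB i j w k⁆).prod = 1 := by
  obtain ⟨l₁, l₂, l₃, h, h₁, h₂, h₃⟩ := exists_finRange_split₂ hij
  have hr := relation (g := g)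
  have e₁ : l₁.map (fun k => ⁅curveTwistA i j w k, curveTwistB i j w k⁆) =
      l₁.map fun k => ⁅a k, b k⁆ := List.map_congr_left fun k hk => by
    have := h₁ k hk
    simp [curveTwistA, curveTwistB, this.ne, (this.trans hij).ne, this.asymm]
  have e₃ : l₃.map (fun k => ⁅curveTwistA i j w k, curveTwistB i j w k⁆) =
      l₃.map fun k => ⁅a k, b k⁆ := List.map_congr_left fun k hk => by
    have := h₃ k hk
    simp [curveTwistA, curveTwistB, this.ne', (hij.trans this).ne', this.asymm]
  have e₂ : l₂.map (fun k => ⁅curveTwistA i j w k, curveTwistB i j w k⁆) =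
      (l₂.map fun k => ⁅a k, b k⁆).map (MulAut.conj ⁅w, a j⁆) := by
    rw [List.map_map]
    refine List.map_congr_left fun k hk => ?_
    have := h₂ k hk
    simp only [curveTwistA, curveTwistB, this.1.ne', this.2.ne, this, if_false, and_self, if_true,
      Function.comp_apply, MulAut.conj_apply]
    simp only [commutatorElement_def]; group
  rw [h] at hr ⊢
  simp only [List.map_append, List.map_cons, List.prod_append, List.prod_cons, e₁, e₂, e₃] at hr ⊢
  rw [← map_list_prod]
  simp only [curveTwistA, curveTwistB, hij.ne, hij.ne', if_true, if_false, lt_irrefl, false_and,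
    and_false, MulAut.conj_apply]
  rw [← hr]
  generalize (l₂.map fun k => ⁅a k, b k⁆).prod = D
  congr 1
  simp only [← mul_assoc]
  congr 1
  have hc : w * curve i j * w⁻¹ = curve i j := by rw [hw.eq]; group
  calc _ = a i * (w * curve i j * w⁻¹) * (a j)⁻¹ * D * ⁅a j, b j⁆ := by
        simp only [commutatorElement_def, curve]; group
    _ = _ := by rw [hc]; simp only [commutatorElement_def, curve]; group

lemma lift_curveTwist {i j : Fin g} (hij : i < j) {w : SurfaceGroup g} (hw) :
    lift (curveTwistA i j w) (curveTwistB i j w) (curveTwist_relation hij w hw) (curve i j) =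
      curve i j := by
  have hc : w * curve i j * w⁻¹ = curve i j := by rw [hw.eq]; group
  conv_rhs => rw [← hc]
  simp [curve, curveTwistA, curveTwistB, hij.ne, mul_assoc]

lemma lift_curveTwist_inverse {i j : Fin g} (hij : i < j) {w : SurfaceGroup g} (hw)
    (hfix : lift (curveTwistA i j w) (curveTwistB i j w) (curveTwist_relation hij w hw) w = w) :
    (∀ k, lift (curveTwistA i j w) (curveTwistB i j w) (curveTwist_relation hij w hw)
      (curveTwistA i j w⁻¹ k) = a k) ∧
    ∀ k, lift (curveTwistA i j w) (curveTwistB i j w) (curveTwist_relation hij w hw)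
      (curveTwistB i j w⁻¹ k) = b k := by
  have haj : lift (curveTwistA i j w) (curveTwistB i j w)
      (curveTwist_relation hij w hw) (a j) = w * a j * w⁻¹ := by simp [curveTwistA]
  constructor
  · intro k
    rw [curveTwistA]
    split_ifs with h1 h2
    · subst h1
      simp only [map_mul, map_inv, hfix, haj]; group
    · simp only [map_mul, map_inv, hfix, haj, map_commutatorElement, lift_a]
      simp only [curveTwistA, h1, h2, if_false, and_self, if_true, commutatorElement_def]; group
    · simp [curveTwistA, h1, h2]
  · intro k
    rw [curveTwistB]
    split_ifs with h0 h1 h2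
    · subst h0
      simp only [map_mul, map_inv, hfix, lift_b]
      simp [curveTwistB]
    · subst h1
      simp only [map_mul, map_inv, hfix, lift_b]
      simp [curveTwistB, h0]
    · simp only [map_mul, map_inv, hfix, haj, map_commutatorElement, lift_b]
      simp only [curveTwistB, h0, h1, h2, if_false, and_self, if_true, commutatorElement_def]; group
    · simp [curveTwistB, h0, h1, h2]

/-- The Dehn twist along `curve i j`. -/
lemma exists_curveTwist {i j : Fin g} (hij : i < j) : ∃ φ : MulAut (SurfaceGroup g),
    φ (a i) = a i ∧ φ (b i) = curve i j * b i ∧ φ (a j) = curve i j * a j * (curve i j)⁻¹ := by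
  have hc : Commute (curve i j) (curve i j) := Commute.refl _
  have h₁ := lift_curveTwist_inverse hij hc (lift_curveTwist hij hc)
  have h₂ := lift_curveTwist_inverse hij hc.inv_left (by
    rw [map_inv, lift_curveTwist hij hc.inv_left])
  simp only [inv_inv] at h₂
  obtain ⟨φ, hφ⟩ := exists_aut _ _ _ _ (curveTwist_relation hij _ hc)
    (curveTwist_relation hij _ hc.inv_left) h₂.1 h₂.2 h₁.1 h₁.2
  refine ⟨φ, ?_, ?_, ?_⟩
  · simp [hφ, curveTwistA, hij.ne]
  · simp [hφ, curveTwistB]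
  · simp [hφ, curveTwistA]

end SurfaceGroup

section Commutant

variable {F : Type*} [Field F]

/-- The centralizer of a non-central element of `GL₂` is commutative. -/
lemma commute_of_commute_noncentral {M X Y Z : GL (Fin 2) F} (hZ : ¬ Commute M Z)
    (hX : Commute M X) (hY : Commute M Y) : Commute X Y := by
  have e : ∀ {P Q : GL (Fin 2) F}, Commute P Q ↔
      (P 0 1 * Q 1 0 = Q 0 1 * P 1 0 ∧ P 0 0 * Q 0 1 + P 0 1 * Q 1 1 = Q 0 0 * P 0 1 + Q 0 1 * P 1 1
      ∧ P 1 0 * Q 0 0 + P 1 1 * Q 1 0 = Q 1 0 * P 0 0 + Q 1 1 * P 1 0) := by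
    intro P Q
    rw [Commute, SemiconjBy, Units.ext_iff]
    simp only [Units.val_mul, ← Matrix.ext_iff, Fin.forall_fin_two, Matrix.mul_apply,
      Fin.sum_univ_two]
    constructor
    · rintro ⟨⟨h1, h2⟩, h3, h4⟩
      exact ⟨by linear_combination h1, h2, h3⟩
    · rintro ⟨h1, h2, h3⟩
      exact ⟨⟨by linear_combination h1, h2⟩, h3, by linear_combination -h1⟩
  rw [e] at *
  generalize M 0 0 = m₁ at *
  generalize M 0 1 = m₂ at *
  generalize M 1 0 = m₃ at *
  generalize M 1 1 = m₄ at *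
  obtain ⟨x1, x2, x3⟩ := hX
  obtain ⟨y1, y2, y3⟩ := hY
  by_cases h2 : m₂ = 0
  · by_cases h3 : m₃ = 0
    · by_cases h4 : m₁ - m₄ = 0
      · refine absurd ⟨?_, ?_, ?_⟩ hZ
        · simp [h2, h3]
        · rw [h2]; linear_combination Z 0 1 * h4
        · rw [h3]; linear_combination -Z 1 0 * h4
      · subst h2 h3
        have hx2 : X 0 1 = 0 := by
          apply (mul_eq_zero_iff_left h4).1; linear_combination x2
        have hx3 : X 1 0 = 0 := by
          apply (mul_eq_zero_iff_left h4).1; linear_combination -x3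
        have hy2 : Y 0 1 = 0 := by
          apply (mul_eq_zero_iff_left h4).1; linear_combination y2
        have hy3 : Y 1 0 = 0 := by
          apply (mul_eq_zero_iff_left h4).1; linear_combination -y3
        simp [hx2, hx3, hy2, hy3]
    · refine ⟨?_, ?_, ?_⟩ <;> apply mul_left_cancel₀ h3 <;> grind
  · refine ⟨?_, ?_, ?_⟩ <;> apply mul_left_cancel₀ h2 <;> grind

/-- A central element of `GL₂` of determinant one squares to one. -/
lemma sq_eq_one_of_central {N : GL (Fin 2) F} (hN : ∀ Z, Commute N Z) (hdet : N.det = 1) :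
    N ^ 2 = 1 := by
  have h₁ := hN (Matrix.GeneralLinearGroup.mkOfDetNeZero !![1, 1; 0, 1] (by simp))
  have h₂ := hN (Matrix.GeneralLinearGroup.mkOfDetNeZero !![1, 0; 1, 1] (by simp))
  have hd : (N : Matrix (Fin 2) (Fin 2) F).det = 1 := by
    simpa using congrArg Units.val hdet
  rw [Commute, SemiconjBy, Units.ext_iff] at h₁ h₂
  simp only [Units.val_mul, ← Matrix.ext_iff, Fin.forall_fin_two, Matrix.mul_apply,
    Fin.sum_univ_two, Matrix.GeneralLinearGroup.mkOfDetNeZero] at h₁ h₂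
  simp at h₁ h₂
  rw [Matrix.det_fin_two] at hd
  rw [Units.ext_iff]
  simp only [sq, Units.val_mul, Units.val_one, ← Matrix.ext_iff, Fin.forall_fin_two,
    Matrix.mul_apply, Fin.sum_univ_two]
  simp
  grind

end Commutant

namespace SurfaceGroup

variable {g : ℕ} {ρ : SurfaceGroup g →* GL (Fin 2) ℂ}

lemma _root_.FiniteAutOrbit.comp {G : Type*} [Group G] {r : ℕ} {ρ : G →* GL (Fin r) ℂ}
    (h : FiniteAutOrbit ρ) (ψ : MulAut G) : FiniteAutOrbit (ρ.comp ψ.toMonoidHom) := by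
  obtain ⟨s, hs, h⟩ := h
  refine ⟨s, hs, fun φ => ?_⟩
  obtain ⟨ρ', hρ', hc⟩ := h (ψ * φ)
  exact ⟨ρ', hρ', hc⟩

/-- Some positive power of any automorphism fixes the class of a representation with
finite orbit. -/
lemma _root_.FiniteAutOrbit.exists_pow {G : Type*} [Group G] {r : ℕ} {ρ : G →* GL (Fin r) ℂ}
    (h : FiniteAutOrbit ρ) (φ : MulAut G) :
    ∃ k : ℕ, 0 < k ∧ ∃ M : GL (Fin r) ℂ, ∀ x, ρ ((φ ^ k) x) = M * ρ x * M⁻¹ := by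
  obtain ⟨s, hs, h⟩ := h
  choose f hf hc using fun n : ℕ => h (φ ^ n)
  have : ∃ m n : ℕ, m < n ∧ f m = f n := by
    have := hs.to_subtype
    obtain ⟨m, n, hmn, he⟩ := Finite.exists_ne_map_eq_of_infinite fun n : ℕ => (⟨f n, hf n⟩ : s)
    have he' : f m = f n := congrArg Subtype.val he
    rcases hmn.lt_or_gt with h | h
    · exact ⟨m, n, h, he'⟩
    · exact ⟨n, m, h, he'.symm⟩
  obtain ⟨m, n, hmn, he⟩ := this
  obtain ⟨P, hP⟩ := hc m
  obtain ⟨Q, hQ⟩ := hc n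
  refine ⟨n - m, by omega, Q⁻¹ * P, fun x => ?_⟩
  have hP' := hP ((φ ^ m)⁻¹ x)
  have hQ' := hQ ((φ ^ m)⁻¹ x)
  rw [← he, hP'] at hQ'
  simp only [MonoidHom.comp_apply, MulEquiv.toMonoidHom_eq_coe, MonoidHom.coe_coe,
    ← MulAut.mul_apply, mul_inv_cancel, MulAut.one_apply] at hQ'
  rw [pow_sub _ hmn.le]
  have e : ρ ((φ ^ n * (φ ^ m)⁻¹) x) = Q⁻¹ * (Q * ρ ((φ ^ n * (φ ^ m)⁻¹) x) * Q⁻¹) * Q := by group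
  rw [e, ← hQ']; group

lemma pow_apply_fixed {G : Type*} [Group G] {φ : MulAut G} {x : G} (h : φ x = x) (k : ℕ) :
    (φ ^ k) x = x := by
  induction k with
  | zero => simp
  | succ k ih => rw [pow_succ, MulAut.mul_apply, h, ih]

lemma pow_apply_mul_right {G : Type*} [Group G] {φ : MulAut G} {x z : G} (hz : φ z = z)
    (h : φ x = x * z) (k : ℕ) : (φ ^ k) x = x * z ^ k := by
  induction k with
  | zero => simp
  | succ k ih => rw [pow_succ, MulAut.mul_apply, h, map_mul, ih, pow_apply_fixed hz, pow_succ,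
      mul_assoc]

lemma pow_apply_mul_left {G : Type*} [Group G] {φ : MulAut G} {x z : G} (hz : φ z = z)
    (h : φ x = z * x) (k : ℕ) : (φ ^ k) x = z ^ k * x := by
  induction k with
  | zero => simp
  | succ k ih => rw [pow_succ, MulAut.mul_apply, h, map_mul, ih, pow_apply_fixed hz, pow_succ',
      mul_assoc]

lemma pow_apply_conj {G : Type*} [Group G] {φ : MulAut G} {x z : G} (hz : φ z = z)
    (h : φ x = z * x * z⁻¹) (k : ℕ) : (φ ^ k) x = z ^ k * x * (z ^ k)⁻¹ := by
  induction k with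
  | zero => simp
  | succ k ih =>
    rw [pow_succ, MulAut.mul_apply, h, map_mul, map_mul, map_inv, ih, pow_apply_fixed hz]
    group

lemma commute_iff_conj_eq {G : Type*} [Group G] {M X : G} :
    Commute M X ↔ X = M * X * M⁻¹ := by
  rw [eq_mul_inv_iff_mul_eq, Commute, SemiconjBy, eq_comm]

/-- If all handles but one are mapped to commuting pairs, so is the last one. -/
lemma commute_of_commute_others {G : Type*} [Group G] (f : SurfaceGroup g →* G) (i : Fin g)
    (h : ∀ j, j ≠ i → Commute (f (a j)) (f (b j))) : Commute (f (a i)) (f (b i)) := by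
  obtain ⟨l₁, l₂, hl, h₁, h₂⟩ := exists_finRange_split i
  have hr := congrArg f (relation (g := g))
  rw [map_one, map_list_prod, List.map_map, hl] at hr
  have e : ∀ l : List (Fin g), (∀ k ∈ l, k ≠ i) →
      (l.map (f ∘ fun k => ⁅a k, b k⁆)).prod = 1 := by
    intro l hk
    refine List.prod_eq_one ?_
    simp only [List.mem_map, forall_exists_index, and_imp]
    rintro _ k hkl rfl
    simpa [map_commutatorElement, commutatorElement_eq_one_iff_commute] using h k (hk k hkl)
  simp only [List.map_append, List.map_cons, List.prod_append, List.prod_cons,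
    e l₁ fun k hk => (h₁ k hk).ne, e l₂ fun k hk => (h₂ k hk).ne', one_mul, mul_one] at hr
  simpa [map_commutatorElement, commutatorElement_eq_one_iff_commute] using hr

lemma det_eq_one_of_conj {M X Y : GL (Fin 2) ℂ} (h : X * Y = M * X * M⁻¹) : Y.det = 1 := by
  have := congrArg Matrix.GeneralLinearGroup.det h
  simpa [mul_comm] using this

/-- Either the intertwiner is central, or it commutes only with commuting pairs. -/
lemma central_or {M : GL (Fin 2) ℂ} : (∀ Z, Commute M Z) ∨
    ∀ X Y, Commute M X → Commute M Y → Commute X Y := by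
  by_cases h : ∀ Z, Commute M Z
  · exact Or.inl h
  · push Not at h
    obtain ⟨Z, hZ⟩ := h
    exact Or.inr fun X Y => commute_of_commute_noncentral hZ

lemma isOfFinOrder_a (h : FiniteAutOrbit ρ) (i : Fin g) : IsOfFinOrder (ρ (a i)) := by
  obtain ⟨φ, hφa, hφb, hφ⟩ := exists_twist i
  obtain ⟨k, hk, M, hM⟩ := h.exists_pow φ
  have hMa : Commute M (ρ (a i)) := by
    rw [commute_iff_conj_eq, ← hM, pow_apply_fixed hφa]
  have hb := hM (b i)
  rw [pow_apply_mul_right hφa hφb, map_mul, map_pow] at hb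
  rw [isOfFinOrder_iff_pow_eq_one]
  have key : Commute M (ρ (b i)) → ρ (a i) ^ k = 1 := fun hc => by
    rwa [← commute_iff_conj_eq.1 hc, mul_eq_left] at hb
  rcases central_or (M := M) with hc | hc
  · exact ⟨k, hk, key (hc _)⟩
  · have hab : Commute (ρ (a i)) (ρ (b i)) := commute_of_commute_others ρ i fun j hj => by
      refine hc _ _ ?_ ?_
      · rw [commute_iff_conj_eq, ← hM, pow_apply_fixed (hφ j hj).1]
      · rw [commute_iff_conj_eq, ← hM, pow_apply_fixed (hφ j hj).2]
    rcases central_or (M := ρ (a i) ^ k) with hN | hN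
    · refine ⟨k * 2, by omega, ?_⟩
      rw [pow_mul]
      exact sq_eq_one_of_central hN (det_eq_one_of_conj hb)
    · exact ⟨k, hk, key (hN _ _ (hMa.symm.pow_left k) (hab.pow_left k))⟩

lemma isOfFinOrder_conj {G : Type*} [Group G] {x y : G} :
    IsOfFinOrder (y * x * y⁻¹) ↔ IsOfFinOrder x :=
  (MulAut.conj y).injective.isOfFinOrder_iff (f := (MulAut.conj y).toMonoidHom)

lemma isOfFinOrder_mul_swap {G : Type*} [Group G] {x y : G} :
    IsOfFinOrder (x * y) ↔ IsOfFinOrder (y * x) := by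
  rw [← isOfFinOrder_conj (x := x * y) (y := y)]
  simp [mul_assoc]

lemma isOfFinOrder_curve (h : FiniteAutOrbit ρ) {i j : Fin g} (hij : i < j) :
    IsOfFinOrder (ρ (curve i j)) := by
  obtain ⟨φ, hφa, hφb, hφ⟩ := exists_curveTwist hij
  have hz : φ (curve i j) = curve i j := by
    conv_lhs => rw [curve]
    simp only [map_mul, map_inv, hφa, hφb, hφ]
    simp only [curve]; group
  obtain ⟨k, hk, M, hM⟩ := h.exists_pow φ
  have hMa : Commute M (ρ (a i)) := by
    rw [commute_iff_conj_eq, ← hM, pow_apply_fixed hφa]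
  have hb := hM (b i)
  rw [pow_apply_mul_left hz hφb, map_mul, map_pow] at hb
  have ha := hM (a j)
  rw [pow_apply_conj hz hφ, map_mul, map_mul, map_inv, map_pow] at ha
  have hai := isOfFinOrder_a h i
  have haj := isOfFinOrder_a h j
  have hs : Commute (ρ (b i) * (ρ (a i))⁻¹ * (ρ (b i))⁻¹) (ρ (a j)) →
      IsOfFinOrder (ρ (curve i j)) := fun hc => by
    simp only [curve, map_mul, map_inv]
    exact hc.isOfFinOrder_mul (isOfFinOrder_conj.2 hai.inv) haj
  generalize hZ : ρ (curve i j) ^ k = Z at *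
  have hN : ∀ {x : GL (Fin 2) ℂ}, Z * x * Z⁻¹ = M * x * M⁻¹ → Commute (Z⁻¹ * M) x := fun {x} hx => by
    rw [commute_iff_conj_eq]
    calc x = Z⁻¹ * (Z * x * Z⁻¹) * Z := by group
      _ = _ := by rw [hx]; group
  rcases central_or (M := Z⁻¹ * M) with hc | hc
  · refine isOfFinOrder_iff_pow_eq_one.2 ⟨k, hk, ?_⟩
    have h1 := (hc (ρ (b i))).eq
    have h2 : M * ρ (b i) = Z * ρ (b i) * M := by rw [hb]; group
    rw [mul_assoc, h2, ← mul_assoc, ← mul_assoc, inv_mul_cancel, one_mul, ← mul_assoc] at h1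
    rw [hZ]
    simpa using h1
  · refine hs (hc _ _ (hN ?_) (hN ha))
    have h1 : M * (ρ (a i))⁻¹ * M⁻¹ = (ρ (a i))⁻¹ :=
      (commute_iff_conj_eq.1 hMa.inv_right).symm
    calc Z * (ρ (b i) * (ρ (a i))⁻¹ * (ρ (b i))⁻¹) * Z⁻¹
        = (Z * ρ (b i)) * (ρ (a i))⁻¹ * (Z * ρ (b i))⁻¹ := by group
      _ = (M * ρ (b i) * M⁻¹) * (M * (ρ (a i))⁻¹ * M⁻¹) * (M * ρ (b i) * M⁻¹)⁻¹ := by rw [hb, h1]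
      _ = _ := by group

end SurfaceGroup

namespace SurfaceGroup

variable {g : ℕ} {ρ : SurfaceGroup g →* GL (Fin 2) ℂ}

lemma isOfFinOrder_commutator (h : FiniteAutOrbit ρ) {i : Fin g}
    (hi : ¬ Commute (ρ (a i)) (ρ (b i))) : IsOfFinOrder ⁅ρ (a i), ρ (b i)⁆ := by
  obtain ⟨S, hSa, hSb, hS⟩ := exists_rotation i
  set c : SurfaceGroup g := ⁅a i, b i⁆ with hcdef
  have hSc : S c = c := by
    simp only [hcdef, commutatorElement_def, map_mul, map_inv, hSa, hSb]; group
  have h4c : (S ^ 4) c⁻¹ = c⁻¹ := by rw [map_inv, pow_apply_fixed hSc]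
  have h4a : (S ^ 4) (a i) = c⁻¹ * a i * c⁻¹⁻¹ := by
    simp only [pow_succ, pow_zero, one_mul, MulAut.mul_apply, map_mul, map_inv, hSa, hSb, hcdef,
      commutatorElement_def]
    group
  have h4b : (S ^ 4) (b i) = c⁻¹ * b i * c⁻¹⁻¹ := by
    simp only [pow_succ, pow_zero, one_mul, MulAut.mul_apply, map_mul, map_inv, hSa, hSb, hcdef,
      commutatorElement_def]
    group
  obtain ⟨k, hk, M, hM⟩ := h.exists_pow (S ^ 4)
  have ha := hM (a i)
  have hb := hM (b i)
  rw [pow_apply_conj h4c h4a] at ha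
  rw [pow_apply_conj h4c h4b] at hb
  rcases central_or (M := M) with hc | hc
  · have hN : ∀ x : SurfaceGroup g, ρ (c⁻¹ ^ k * x * (c⁻¹ ^ k)⁻¹) = M * ρ x * M⁻¹ →
        Commute (ρ c ^ k) (ρ x) := fun x hx => by
      rw [← commute_iff_conj_eq.1 (hc _)] at hx
      rw [← Commute.inv_left_iff, commute_iff_conj_eq]
      simpa using hx.symm
    rcases central_or (M := ρ c ^ k) with hC | hC
    · have hdet : (ρ c ^ k).det = 1 := by
        simp [hcdef, commutatorElement_def]
      refine isOfFinOrder_iff_pow_eq_one.2 ⟨k * 2, by omega, ?_⟩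
      rw [← map_commutatorElement, pow_mul]
      exact sq_eq_one_of_central hC hdet
    · exact absurd (hC _ _ (hN _ ha) (hN _ hb)) hi
  · refine absurd (commute_of_commute_others ρ i fun j hj => hc _ _ ?_ ?_) hi
    · rw [commute_iff_conj_eq, ← hM, pow_apply_fixed (pow_apply_fixed (hS j hj).1 4)]
    · rw [commute_iff_conj_eq, ← hM, pow_apply_fixed (pow_apply_fixed (hS j hj).2 4)]

/-- The simple closed curves `aᵢ`, `bᵢ⁻¹` and `aᵢ bᵢ⁻¹` on the `i`-th handle. -/
def handleWords (i : Fin g) : Set (SurfaceGroup g) := {a i, (b i)⁻¹, a i * (b i)⁻¹}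

lemma exists_aut_handleWord {i : Fin g} {y : SurfaceGroup g} (hy : y ∈ handleWords i) :
    ∃ φ : MulAut (SurfaceGroup g), φ (a i) = y ∧
      ∀ j, j ≠ i → φ (a j) = a j ∧ φ (b j) = b j := by
  obtain ⟨S, hSa, hSb, hS⟩ := exists_rotation i
  obtain ⟨T, hTa, hTb, hT⟩ := exists_twist i
  have hSi : ∀ j, j ≠ i → S⁻¹ (a j) = a j ∧ S⁻¹ (b j) = b j := fun j hj =>
    ⟨S.symm_apply_eq.2 (hS j hj).1.symm, S.symm_apply_eq.2 (hS j hj).2.symm⟩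
  have hSia : S⁻¹ (a i) = a i * b i * (a i)⁻¹ := by
    refine S.symm_apply_eq.2 ?_
    simp only [map_mul, map_inv, hSa, hSb]; group
  rcases hy with rfl | rfl | rfl
  · exact ⟨1, rfl, fun j _ => ⟨rfl, rfl⟩⟩
  · exact ⟨S, hSa, hS⟩
  · refine ⟨S * T * S⁻¹, ?_, fun j hj => ?_⟩
    · simp only [MulAut.mul_apply, hSia, map_mul, map_inv, hTa, hTb, hSa, hSb]; group
    · simp [MulAut.mul_apply, hSi j hj, hT j hj, hS j hj]

lemma apply_handleWord {φ : MulAut (SurfaceGroup g)} {j : Fin g}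
    (h : φ (a j) = a j ∧ φ (b j) = b j) {x : SurfaceGroup g} (hx : x ∈ handleWords j) :
    φ x = x := by
  rcases hx with rfl | rfl | rfl <;> simp [h]

lemma exists_aut_handleWords {i j : Fin g} (hij : i ≠ j) {y x : SurfaceGroup g}
    (hy : y ∈ handleWords i) (hx : x ∈ handleWords j) :
    ∃ φ : MulAut (SurfaceGroup g), φ (a i) = y ∧ φ (a j) = x := by
  obtain ⟨φ, hφ, hφ'⟩ := exists_aut_handleWord hy
  obtain ⟨ψ, hψ, hψ'⟩ := exists_aut_handleWord hx
  refine ⟨φ * ψ, ?_, ?_⟩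
  · rw [MulAut.mul_apply, (hψ' i hij).1, hφ]
  · rw [MulAut.mul_apply, hψ, apply_handleWord (hφ' j hij.symm) hx]

lemma isOfFinOrder_handleWord (h : FiniteAutOrbit ρ) {i : Fin g} {y : SurfaceGroup g}
    (hy : y ∈ handleWords i) : IsOfFinOrder (ρ y) := by
  obtain ⟨φ, hφ, -⟩ := exists_aut_handleWord hy
  simpa [hφ] using isOfFinOrder_a (h.comp φ) i

lemma isOfFinOrder_handleWord_mul (h : FiniteAutOrbit ρ) {i j : Fin g} (hij : i ≠ j)
    {y x : SurfaceGroup g} (hy : y ∈ handleWords i) (hx : x ∈ handleWords j) :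
    IsOfFinOrder (ρ y * ρ x) := by
  wlog hlt : i < j generalizing i j x y
  · exact isOfFinOrder_mul_swap.1 (this hij.symm hx hy (hij.lt_or_gt.resolve_left hlt))
  obtain ⟨φ, hφi, hφj⟩ := exists_aut_handleWords hij hy hx
  obtain ⟨S, hSa, hSb, hS⟩ := exists_rotation i
  have hS' : (S * S) (a i * a j) = curve i j := by
    simp only [MulAut.mul_apply, map_mul, map_inv, hSa, hSb, hS j hij.symm, curve]; group
  have e : (φ * (S * S)⁻¹) (curve i j) = y * x := by
    rw [← hS', MulAut.mul_apply, MulAut.inv_apply_self, map_mul, hφi, hφj]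
  rw [← map_mul, ← e]
  exact isOfFinOrder_curve (h.comp (φ * (S * S)⁻¹)) hlt

lemma commute_handleWords {G : Type*} [Group G] {f : SurfaceGroup g →* G}
    (h : ∀ (φ : MulAut (SurfaceGroup g)) (i : Fin g), Commute (f (φ (a i))) (f (φ (b i))))
    {i j : Fin g} (hij : i < j) {y x : SurfaceGroup g}
    (hy : y ∈ handleWords i) (hx : x ∈ handleWords j) : Commute (f y) (f x) := by
  obtain ⟨φ, rfl, rfl⟩ := exists_aut_handleWords hij.ne hy hx
  obtain ⟨ψ, hψa, hψb, -⟩ := exists_curveTwist hij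
  have h₁ := h φ i
  have h₂ := h (φ * ψ) i
  have e : a j = b i * a i * (b i)⁻¹ * (curve i j * b i) * (b i)⁻¹ := by rw [curve]; group
  rw [MulAut.mul_apply, MulAut.mul_apply, hψa, hψb] at h₂
  rw [e]
  simp only [map_mul, map_inv] at h₂ ⊢
  exact (((h₁.mul_right (Commute.refl _)).mul_right h₁.inv_right).mul_right h₂).mul_right
    h₁.inv_right

end SurfaceGroup

section Eigenvalues

open Polynomial ComplexConjugate

/-- The eigenvalues of a complex `2 × 2` matrix. -/
lemma Matrix.exists_eigenvalues (U : Matrix (Fin 2) (Fin 2) ℂ) :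
    ∃ l m : ℂ, U.trace = l + m ∧ U.det = l * m ∧
      ∀ p : ℂ[X], aeval U p = 0 → p.eval l = 0 ∧ p.eval m = 0 := by
  obtain ⟨e, he⟩ := IsAlgClosed.exists_pow_nat_eq (U.trace ^ 2 - 4 * U.det) two_pos
  have key : ∀ l : ℂ, l ^ 2 - U.trace * l + U.det = 0 → ∀ p : ℂ[X], aeval U p = 0 →
      p.eval l = 0 := by
    intro l hl p hp
    obtain ⟨q, hq⟩ := X_sub_C_dvd_sub_C_eval (a := l) (p := p)
    have h := congrArg (fun P => (aeval U P).det) hq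
    have h₀ : (U - algebraMap ℂ _ l).det = 0 := by
      rw [← hl, Matrix.det_fin_two, Matrix.det_fin_two,
        Matrix.trace_fin_two]
      simp [Matrix.algebraMap_matrix_apply]
      ring
    simp only [map_mul, Matrix.det_mul, map_sub, aeval_X, hp, zero_sub, aeval_C, h₀, zero_mul] at h
    rw [Matrix.det_fin_two] at h
    simpa [Matrix.algebraMap_matrix_apply] using h
  refine ⟨(U.trace + e) / 2, (U.trace - e) / 2, by ring, ?_, fun p hp =>
    ⟨key _ ?_ p hp, key _ ?_ p hp⟩⟩
  · linear_combination he / 4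
  · linear_combination he / 4
  · linear_combination he / 4

lemma Matrix.isIntegral_trace_complex {U : Matrix (Fin 2) (Fin 2) ℂ} (h : IsIntegral ℤ U) :
    IsIntegral ℤ U.trace := by
  obtain ⟨l, m, ht, -, hlm⟩ := U.exists_eigenvalues
  obtain ⟨p, hp, hpU⟩ := h
  have := hlm (p.map (algebraMap ℤ ℂ)) (by rwa [aeval_map_algebraMap])
  rw [ht]
  refine IsIntegral.add ⟨p, hp, ?_⟩ ⟨p, hp, ?_⟩
  · simpa [eval_map] using this.1
  · simpa [eval_map] using this.2

lemma Matrix.isIntegral_trace {K : Type*} [Field K] [NumberField K] {U : Matrix (Fin 2) (Fin 2) K}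
    (h : IsIntegral ℤ U) : IsIntegral ℤ U.trace := by
  let f : K →+* ℂ := Classical.arbitrary _
  rw [← isIntegral_algHom_iff f.toIntAlgHom f.injective]
  have h' := Matrix.isIntegral_trace_complex (h.map f.mapMatrix.toIntAlgHom)
  simpa [Matrix.trace] using h'

lemma IsOfFinOrder.isIntegral_coe {K : Type*} [Field K] {U : GL (Fin 2) K}
    (h : IsOfFinOrder U) : IsIntegral ℤ (U : Matrix (Fin 2) (Fin 2) K) := by
  obtain ⟨n, hn, hU⟩ := isOfFinOrder_iff_pow_eq_one.1 h
  refine ⟨X ^ n - 1, monic_X_pow_sub_C 1 hn.ne', ?_⟩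
  simp [← Units.val_pow_eq_pow_val, hU]

lemma IsOfFinOrder.isIntegral_det {K : Type*} [Field K] {U : GL (Fin 2) K}
    (h : IsOfFinOrder U) : IsIntegral ℤ U.1.det := by
  obtain ⟨n, hn, hU⟩ := isOfFinOrder_iff_pow_eq_one.1 h
  refine ⟨X ^ n - 1, monic_X_pow_sub_C 1 hn.ne', ?_⟩
  simp [← Matrix.det_pow, ← Units.val_pow_eq_pow_val, hU]

lemma IsOfFinOrder.exists_eigenvalues {U : GL (Fin 2) ℂ} (h : IsOfFinOrder U) :
    ∃ l m : ℂ, U.1.trace = l + m ∧ U.1.det = l * m ∧ l * conj l = 1 ∧ m * conj m = 1 := by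
  obtain ⟨n, hn, hU⟩ := isOfFinOrder_iff_pow_eq_one.1 h
  obtain ⟨l, m, ht, hd, hlm⟩ := U.1.exists_eigenvalues
  have := hlm (X ^ n - 1) (by simp [← Units.val_pow_eq_pow_val, hU])
  have e : ∀ z : ℂ, z ^ n - 1 = 0 → z * conj z = 1 := fun z hz => by
    rw [Complex.mul_conj', Complex.norm_eq_one_of_pow_eq_one (sub_eq_zero.1 hz) hn.ne']
    simp
  exact ⟨l, m, ht, hd, e l (by simpa using this.1), e m (by simpa using this.2)⟩

lemma IsOfFinOrder.conj_trace_mul_det {U : GL (Fin 2) ℂ} (h : IsOfFinOrder U) :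
    conj U.1.trace * U.1.det = U.1.trace := by
  obtain ⟨l, m, ht, hd, hl, hm⟩ := h.exists_eigenvalues
  rw [ht, hd, map_add]
  linear_combination m * hl + l * hm

lemma IsOfFinOrder.det_mul_conj {U : GL (Fin 2) ℂ} (h : IsOfFinOrder U) :
    U.1.det * conj U.1.det = 1 := by
  obtain ⟨l, m, -, hd, hl, hm⟩ := h.exists_eigenvalues
  rw [hd, map_mul]
  linear_combination m * conj m * hl + hm

lemma IsOfFinOrder.re_trace_le {U : GL (Fin 2) ℂ} (h : IsOfFinOrder U) : U.1.trace.re ≤ 2 := by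
  obtain ⟨l, m, ht, -, hl, hm⟩ := h.exists_eigenvalues
  have e : ∀ z : ℂ, z * conj z = 1 → z.re ≤ 1 := fun z hz => by
    have := congrArg Complex.re hz
    simp at this
    nlinarith [mul_self_nonneg z.im]
  rw [ht, Complex.add_re]
  linarith [e l hl, e m hm]

/-- A finite-order element with a double eigenvalue is scalar. -/
lemma IsOfFinOrder.eq_scalar {U : GL (Fin 2) ℂ} (h : IsOfFinOrder U) {l : ℂ}
    (ht : U.1.trace = 2 * l) (hd : U.1.det = l ^ 2) : U.1 = l • 1 := by
  obtain ⟨n, hn, hU⟩ := isOfFinOrder_iff_pow_eq_one.1 h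
  have hN : (U.1 - l • 1) * (U.1 - l • 1) = 0 := by
    rw [Matrix.trace_fin_two] at ht
    rw [Matrix.det_fin_two] at hd
    ext i j
    fin_cases i <;> fin_cases j <;>
      simp [Matrix.mul_apply, Fin.sum_univ_two] <;> grind
  have hl : l ≠ 0 := by
    rintro rfl
    exact U.det_ne_zero (by simpa using hd)
  have hpow : ∀ k : ℕ, U.1 ^ (k + 1) = l ^ (k + 1) • 1 + ((k + 1) * l ^ k) • (U.1 - l • 1) := by
    intro k
    induction k with
    | zero => simp
    | succ k ih =>
      have e : U.1 = l • 1 + (U.1 - l • 1) := by abel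
      rw [pow_succ, ih]
      nth_rw 2 [e]
      simp only [mul_add, add_mul, Matrix.smul_mul, Matrix.mul_smul, hN, mul_one, one_mul,
        smul_zero, add_zero, smul_smul, add_assoc, ← add_smul]
      push_cast
      congr 2 <;> ring_nf
  obtain ⟨k, rfl⟩ : ∃ k, n = k + 1 := ⟨n - 1, by omega⟩
  have h₁ := hpow k
  have h₂ : l ^ (k + 1) = 1 := by
    obtain ⟨l', m', ht', hd', hlm⟩ := U.1.exists_eigenvalues
    have e : l' = l := by
      have : (l' - l) ^ 2 = 0 := by
        linear_combination l' * (ht - ht') + hd' - hd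
      exact sub_eq_zero.1 (pow_eq_zero_iff two_ne_zero |>.1 this)
    have := (hlm (X ^ (k + 1) - 1) (by simp [← Units.val_pow_eq_pow_val, hU])).1
    rw [e] at this
    exact sub_eq_zero.1 (by simpa using this)
  rw [← Units.val_pow_eq_pow_val, hU, h₂, one_smul, Units.val_one, left_eq_add,
    smul_eq_zero] at h₁
  refine sub_eq_zero.1 (h₁.resolve_left (mul_ne_zero ?_ (pow_ne_zero _ hl)))
  exact_mod_cast k.succ_ne_zero

end Eigenvalues

section Integrality

open Matrix NumberField

variable {R K : Type*} [CommRing R] [Field K] [Algebra R K]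

/-- The span of the ordered products of elements of a list of `2 × 2` matrices. -/
def Matrix.orderedSpan (R : Type*) {K : Type*} [CommRing R] [Field K] [Algebra R K] :
    List (Matrix (Fin 2) (Fin 2) K) → Submodule R (Matrix (Fin 2) (Fin 2) K)
  | [] => R ∙ 1
  | X :: l => orderedSpan R l ⊔ (orderedSpan R l).map (LinearMap.mulRight R X)

lemma Matrix.orderedSpan_fg (l : List (Matrix (Fin 2) (Fin 2) K)) : (orderedSpan R l).FG := by
  induction l with
  | nil => exact Submodule.fg_span_singleton 1
  | cons X l ih => exact ih.sup (ih.map _)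

lemma Matrix.one_mem_orderedSpan (l : List (Matrix (Fin 2) (Fin 2) K)) : 1 ∈ orderedSpan R l := by
  induction l with
  | nil => exact Submodule.mem_span_singleton_self 1
  | cons X l ih => exact Submodule.mem_sup_left ih

/-- The span of the ordered products is stable under right multiplication when the traces of
products of pairs are integral. -/
lemma Matrix.mul_mem_orderedSpan {l : List (Matrix (Fin 2) (Fin 2) K)}
    (ht : ∀ X ∈ l, X.trace ∈ Set.range (algebraMap R K))
    (hd : ∀ X ∈ l, X.det ∈ Set.range (algebraMap R K))
    (hp : ∀ X ∈ l, ∀ Y ∈ l, (X * Y).trace ∈ Set.range (algebraMap R K))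
    {Z Y : Matrix (Fin 2) (Fin 2) K} (hZ : Z ∈ orderedSpan R l) (hY : Y ∈ l) :
    Z * Y ∈ orderedSpan R l := by
  induction l generalizing Z Y with
  | nil => simp at hY
  | cons X l ih =>
    have hsq : X * X = X.trace • X - X.det • 1 := by
      rw [trace_fin_two, det_fin_two]
      ext i j
      fin_cases i <;> fin_cases j <;> simp [mul_apply, Fin.sum_univ_two] <;> ring
    have hcomm : X * Y = X.trace • Y + Y.trace • X + ((X * Y).trace - X.trace * Y.trace) • 1
        - Y * X := by
      simp only [trace_fin_two, mul_apply, Fin.sum_univ_two]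
      ext i j
      fin_cases i <;> fin_cases j <;> simp [mul_apply, Fin.sum_univ_two] <;> ring
    have ih' : ∀ {Z Y}, Z ∈ orderedSpan R l → Y ∈ l → Z * Y ∈ orderedSpan R l := fun hZ hY =>
      ih (fun X hX => ht X (List.mem_cons_of_mem _ hX)) (fun X hX => hd X (List.mem_cons_of_mem _ hX))
        (fun X hX Y hY => hp X (List.mem_cons_of_mem _ hX) Y (List.mem_cons_of_mem _ hY)) hZ hY
    have hr : ∀ {Z}, Z ∈ orderedSpan R l → Z * X ∈ orderedSpan R (X :: l) := fun hZ =>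
      Submodule.mem_sup_right ⟨_, hZ, rfl⟩
    have hl : ∀ {Z}, Z ∈ orderedSpan R l → Z ∈ orderedSpan R (X :: l) := fun hZ =>
      Submodule.mem_sup_left hZ
    obtain ⟨Z₁, hZ₁, _, ⟨Z₂, hZ₂, rfl⟩, rfl⟩ := Submodule.mem_sup.1 hZ
    rw [LinearMap.mulRight_apply, add_mul]
    obtain ⟨t, htX⟩ := ht X List.mem_cons_self
    obtain ⟨d, hdX⟩ := hd X List.mem_cons_self
    rcases List.mem_cons.1 hY with rfl | hYl
    · refine add_mem (hr hZ₁) ?_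
      rw [mul_assoc, hsq, ← htX, ← hdX, algebraMap_smul, algebraMap_smul, mul_sub, mul_smul_comm,
        mul_smul_comm, mul_one]
      exact sub_mem (Submodule.smul_mem _ _ (hr hZ₂)) (Submodule.smul_mem _ _ (hl hZ₂))
    · obtain ⟨t', htY⟩ := ht Y hY
      obtain ⟨p, hpXY⟩ := hp X List.mem_cons_self Y hY
      refine add_mem (hl (ih' hZ₁ hYl)) ?_
      rw [mul_assoc, hcomm, ← htX, ← htY, ← hpXY, ← map_mul, ← map_sub, algebraMap_smul,
        algebraMap_smul, algebraMap_smul, mul_sub, mul_add, mul_add, mul_smul_comm,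
        mul_smul_comm, mul_smul_comm, mul_one, ← mul_assoc]
      exact sub_mem (add_mem (add_mem (Submodule.smul_mem _ _ (hl (ih' hZ₂ hYl)))
        (Submodule.smul_mem _ _ (hr hZ₂))) (Submodule.smul_mem _ _ (hl hZ₂))) (hr (ih' hZ₂ hYl))

lemma GL2.isIntegral_of_mem_closure [NumberField K] {s : Set (GL (Fin 2) K)} (hs : s.Finite)
    (h₁ : ∀ X ∈ s, IsOfFinOrder X) (h₂ : ∀ X ∈ s, ∀ Y ∈ s, IsOfFinOrder (X * Y))
    {W : GL (Fin 2) K} (hW : W ∈ Submonoid.closure s) :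
    IsIntegral ℤ (W : Matrix (Fin 2) (Fin 2) K) := by
  have hint : ∀ {x : K}, IsIntegral ℤ x → x ∈ Set.range (algebraMap (𝓞 K) K) := fun hx =>
    ⟨⟨_, hx⟩, rfl⟩
  set l : List (Matrix (Fin 2) (Fin 2) K) := hs.toFinset.toList.map Units.val with hl
  have hmem : ∀ {X}, X ∈ l ↔ ∃ Y ∈ s, Y.1 = X := by simp [hl]
  have hmul : ∀ {Z Y}, Z ∈ orderedSpan (𝓞 K) l → Y ∈ l → Z * Y ∈ orderedSpan (𝓞 K) l := by
    refine fun hZ hY => mul_mem_orderedSpan ?_ ?_ ?_ hZ hY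
    · intro X hX
      obtain ⟨X, hX', rfl⟩ := hmem.1 hX
      exact hint (Matrix.isIntegral_trace (h₁ X hX').isIntegral_coe)
    · intro X hX
      obtain ⟨X, hX', rfl⟩ := hmem.1 hX
      exact hint (h₁ X hX').isIntegral_det
    · intro X hX Y hY
      obtain ⟨X, hX', rfl⟩ := hmem.1 hX
      obtain ⟨Y, hY', rfl⟩ := hmem.1 hY
      exact hint (Matrix.isIntegral_trace (h₂ X hX' Y hY').isIntegral_coe)
  have hle : ∀ W ∈ Submonoid.closure s, W.1 ∈ orderedSpan (𝓞 K) l := by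
    intro W hW
    induction hW using Submonoid.closure_induction_right with
    | one => exact one_mem_orderedSpan l
    | mul_right x _ y hy ih => exact hmul ih (hmem.2 ⟨y, hy, rfl⟩)
  have hsub : Subalgebra.toSubmodule (Algebra.adjoin (𝓞 K)
      ((Submonoid.closure s).map (Units.coeHom _) : Set (Matrix (Fin 2) (Fin 2) K))) ≤
      orderedSpan (𝓞 K) l := by
    rw [Algebra.adjoin_eq_span, Submonoid.closure_eq]
    refine Submodule.span_le.2 ?_
    rintro _ ⟨W, hW, rfl⟩
    exact hle W hW
  have hfg : (Subalgebra.toSubmodule (Algebra.adjoin (𝓞 K)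
      ((Submonoid.closure s).map (Units.coeHom _) : Set (Matrix (Fin 2) (Fin 2) K)))).FG :=
    Submodule.FG.of_le (orderedSpan_fg l) hsub
  have h := IsIntegral.of_mem_of_fg _ hfg W.1 (Algebra.subset_adjoin ⟨W, hW, rfl⟩)
  have : @IsScalarTower ℤ (𝓞 K) (Matrix (Fin 2) (Fin 2) K) Algebra.toSMul Algebra.toSMul
      Algebra.toSMul := IsScalarTower.of_algebraMap_eq fun x => by simp
  exact isIntegral_trans (A := 𝓞 K) _ h

end Integrality

/-- A finite set of group elements for which enough short products have finite order. -/
structure EllipticSystem {G : Type*} [Group G] (A B : G) (s : Set G) : Prop where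
  finite : s.Finite
  left : IsOfFinOrder A
  right : IsOfFinOrder B
  mul : IsOfFinOrder (A * B)
  commutator : IsOfFinOrder ⁅A, B⁆
  mem : ∀ X ∈ s, IsOfFinOrder X
  left_mul : ∀ X ∈ s, IsOfFinOrder (A * X)
  right_mul : ∀ X ∈ s, IsOfFinOrder (B * X)
  mul_mul : ∀ X ∈ s, IsOfFinOrder (A * B * X)
  pair : ∀ X ∈ s, ∀ Y ∈ s, IsOfFinOrder (X * Y)

namespace EllipticSystem

variable {G H : Type*} [Group G] [Group H] {A B : G} {s : Set G}

lemma image (h : EllipticSystem A B s) (f : G →* H) : EllipticSystem (f A) (f B) (f '' s) where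
  finite := h.finite.image f
  left := f.isOfFinOrder h.left
  right := f.isOfFinOrder h.right
  mul := by simpa using f.isOfFinOrder h.mul
  commutator := by simpa using f.isOfFinOrder h.commutator
  mem := by rintro _ ⟨X, hX, rfl⟩; exact f.isOfFinOrder (h.mem X hX)
  left_mul := by rintro _ ⟨X, hX, rfl⟩; simpa using f.isOfFinOrder (h.left_mul X hX)
  right_mul := by rintro _ ⟨X, hX, rfl⟩; simpa using f.isOfFinOrder (h.right_mul X hX)
  mul_mul := by rintro _ ⟨X, hX, rfl⟩; simpa using f.isOfFinOrder (h.mul_mul X hX)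
  pair := by
    rintro _ ⟨X, hX, rfl⟩ _ ⟨Y, hY, rfl⟩
    simpa using f.isOfFinOrder (h.pair X hX Y hY)

lemma of_image {f : G →* H} (hf : Function.Injective f)
    (h : EllipticSystem (f A) (f B) (f '' s)) : EllipticSystem A B s where
  finite := h.finite.of_finite_image hf.injOn
  left := hf.isOfFinOrder_iff.1 h.left
  right := hf.isOfFinOrder_iff.1 h.right
  mul := hf.isOfFinOrder_iff.1 (by simpa using h.mul)
  commutator := hf.isOfFinOrder_iff.1 (by simpa using h.commutator)
  mem X hX := hf.isOfFinOrder_iff.1 (h.mem _ ⟨X, hX, rfl⟩)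
  left_mul X hX := hf.isOfFinOrder_iff.1 (by simpa using h.left_mul _ ⟨X, hX, rfl⟩)
  right_mul X hX := hf.isOfFinOrder_iff.1 (by simpa using h.right_mul _ ⟨X, hX, rfl⟩)
  mul_mul X hX := hf.isOfFinOrder_iff.1 (by simpa using h.mul_mul _ ⟨X, hX, rfl⟩)
  pair X hX Y hY :=
    hf.isOfFinOrder_iff.1 (by simpa using h.pair _ ⟨X, hX, rfl⟩ _ ⟨Y, hY, rfl⟩)

lemma isOfFinOrder_insert (h : EllipticSystem A B s) :
    ∀ X ∈ insert A (insert B s), IsOfFinOrder X := by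
  rintro X (rfl | rfl | hX)
  exacts [h.left, h.right, h.mem X hX]

lemma isOfFinOrder_mul_insert (h : EllipticSystem A B s) :
    ∀ X ∈ insert A (insert B s), ∀ Y ∈ insert A (insert B s), IsOfFinOrder (X * Y) := by
  have hswap : ∀ {x y : G}, IsOfFinOrder (x * y) → IsOfFinOrder (y * x) :=
    SurfaceGroup.isOfFinOrder_mul_swap.1
  rintro X (rfl | rfl | hX) Y (rfl | rfl | hY)
  · exact (Commute.refl _).isOfFinOrder_mul h.left h.left
  · exact h.mul
  · exact h.left_mul Y hY
  · exact hswap h.mul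
  · exact (Commute.refl _).isOfFinOrder_mul h.right h.right
  · exact h.right_mul Y hY
  · exact hswap (h.left_mul X hX)
  · exact hswap (h.right_mul X hX)
  · exact h.pair X hX Y hY

/-- The subgroup generated by an elliptic system is generated by it as a monoid. -/
lemma mem_submonoid_closure (h : EllipticSystem A B s) {W : G}
    (hW : W ∈ Subgroup.closure (insert A (insert B s))) :
    W ∈ Submonoid.closure (insert A (insert B s)) := by
  rw [← Subgroup.closure_toSubmonoid_of_isOfFinOrder h.isOfFinOrder_insert]
  exact hW

end EllipticSystem

section Unitary

open ComplexConjugate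

/-- The matrices preserving the hermitian form `diag (h, 1)` on row vectors, up to the choice of
normalisation. -/
def IsUnitaryFor (h : ℝ) (X : Matrix (Fin 2) (Fin 2) ℂ) : Prop :=
  X.det * conj X.det = 1 ∧ X 1 1 = X.det * conj (X 0 0) ∧ X 1 0 = -h * X.det * conj (X 0 1)

lemma IsUnitaryFor.one {h : ℝ} : IsUnitaryFor h 1 := by simp [IsUnitaryFor]

lemma IsUnitaryFor.mul {h : ℝ} {X Y : Matrix (Fin 2) (Fin 2) ℂ} (hX : IsUnitaryFor h X)
    (hY : IsUnitaryFor h Y) : IsUnitaryFor h (X * Y) := by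
  obtain ⟨hX, hX1, hX2⟩ := hX
  obtain ⟨hY, hY1, hY2⟩ := hY
  simp only [IsUnitaryFor, Matrix.det_mul, Matrix.mul_apply, Fin.sum_univ_two]
  have hcY : conj (Y 1 0) = -h * conj Y.det * Y 0 1 := by rw [hY2]; simp
  have hcY' : conj (Y 1 1) = conj Y.det * Y 0 0 := by rw [hY1]; simp
  generalize X.det = d at *
  generalize Y.det = e at *
  simp only [map_mul, map_add, hX1, hX2, hY1, hY2, map_neg, Complex.conj_ofReal, Complex.conj_conj]
  refine ⟨by linear_combination e * conj e * hX + hY, ?_, ?_⟩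
  · linear_combination (d * conj (X 0 1) * Y 0 1 * h) * hY
  · linear_combination (h * d * conj (X 0 1) * Y 0 0) * hY

lemma IsUnitaryFor.norm_trace_le {h : ℝ} (hh : 0 ≤ h) {X : Matrix (Fin 2) (Fin 2) ℂ}
    (hX : IsUnitaryFor h X) : ‖X.trace‖ ≤ 2 := by
  obtain ⟨hd, h1, h2⟩ := hX
  have hdn : ‖X.det‖ = 1 := by
    have := congrArg norm hd
    rw [norm_mul, RCLike.norm_conj, norm_one] at this
    nlinarith [norm_nonneg X.det]
  have hd0 : X.det ≠ 0 := fun h => by simp [h] at hd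
  have key : X 0 0 * conj (X 0 0) + h * (X 0 1 * conj (X 0 1)) = 1 := by
    have := Matrix.det_fin_two X
    rw [h1, h2] at this
    apply mul_left_cancel₀ hd0
    linear_combination -this
  rw [Complex.mul_conj', Complex.mul_conj'] at key
  have key' : ‖X 0 0‖ ^ 2 + h * ‖X 0 1‖ ^ 2 = 1 := by exact_mod_cast key
  have hle : ‖X 0 0‖ ≤ 1 := by
    nlinarith [norm_nonneg (X 0 0), mul_nonneg hh (sq_nonneg ‖X 0 1‖)]
  rw [Matrix.trace_fin_two]
  refine (norm_add_le _ _).trans ?_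
  rw [h1, norm_mul, hdn, RCLike.norm_conj]
  linarith

/-- The diagonal of `X` is determined up to conjugation by the traces of `X` and `A X`. -/
lemma diagonal_eq_of_isOfFinOrder {A X : GL (Fin 2) ℂ} (hA01 : A 0 1 = 0) (hA10 : A 1 0 = 0)
    (hne : A 0 0 ≠ A 1 1) (h0 : A 0 0 * conj (A 0 0) = 1) (h1 : A 1 1 * conj (A 1 1) = 1)
    (hX : IsOfFinOrder X) (hAX : IsOfFinOrder (A * X)) : X 1 1 = X.1.det * conj (X 0 0) := by
  have e₁ := hX.conj_trace_mul_det
  have e₂ := hAX.conj_trace_mul_det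
  have hAd : A.1.det = A 0 0 * A 1 1 := by rw [Matrix.det_fin_two, hA01]; ring
  rw [Units.val_mul, Matrix.det_mul, hAd] at e₂
  generalize X.1.det = d at *
  simp only [Matrix.trace_fin_two, Matrix.mul_apply, Fin.sum_univ_two, hA01, hA10,
    map_add, map_mul, zero_mul, zero_add, add_zero] at e₁ e₂
  apply mul_left_cancel₀ (sub_ne_zero.2 hne)
  linear_combination e₂ - A 0 0 * e₁ - d * conj (X 0 0) * A 1 1 * h0
    - d * conj (X 1 1) * A 0 0 * h1

/-- An elliptic system with diagonal first element preserves a definite hermitian form. -/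
lemma EllipticSystem.exists_isUnitaryFor {A B : GL (Fin 2) ℂ} {s : Set (GL (Fin 2) ℂ)}
    (h : EllipticSystem A B s) (hA01 : A 0 1 = 0) (hA10 : A 1 0 = 0) (hne : A 0 0 ≠ A 1 1)
    (hB01 : B 0 1 ≠ 0) :
    ∃ r : ℝ, 0 ≤ r ∧ ∀ X ∈ insert A (insert B s), IsUnitaryFor r X.1 := by
  have hAd : A.1.det = A 0 0 * A 1 1 := by rw [Matrix.det_fin_two, hA01]; ring
  obtain ⟨h0, h1⟩ : A 0 0 * conj (A 0 0) = 1 ∧ A 1 1 * conj (A 1 1) = 1 := by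
    obtain ⟨l, m, ht, hd, hl, hm⟩ := h.left.exists_eigenvalues
    rw [Matrix.trace_fin_two] at ht
    rw [hAd] at hd
    have e : ∀ z, z = A 0 0 ∨ z = A 1 1 → z * conj z = 1 := fun z hz => by
      have : (z - l) * (z - m) = 0 := by
        rcases hz with rfl | rfl
        · linear_combination A 0 0 * ht - hd
        · linear_combination A 1 1 * ht - hd
      rcases mul_eq_zero.1 this with h | h
      · rwa [sub_eq_zero.1 h]
      · rwa [sub_eq_zero.1 h]
    exact ⟨e _ (Or.inl rfl), e _ (Or.inr rfl)⟩
  have hdiag : ∀ {X : GL (Fin 2) ℂ}, IsOfFinOrder X → IsOfFinOrder (A * X) →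
      X 1 1 = X.1.det * conj (X 0 0) :=
    fun hX hAX => diagonal_eq_of_isOfFinOrder hA01 hA10 hne h0 h1 hX hAX
  have hB11 := hdiag h.right h.mul
  have hBd := h.right.det_mul_conj
  have hBdet := Matrix.det_fin_two B.1
  have hd0 : B.1.det ≠ 0 := B.det_ne_zero
  rw [hB11] at hBdet
  have hr : B 0 1 * B 1 0 = B.1.det * (‖B 0 0‖ ^ 2 - 1) := by
    rw [← Complex.mul_conj']; linear_combination hBdet
  have hq : (‖B 0 1‖ : ℂ) ≠ 0 := by simpa using hB01
  set r : ℝ := (1 - ‖B 0 0‖ ^ 2) / ‖B 0 1‖ ^ 2 with hrdef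
  have hB10 : B 1 0 = -r * B.1.det * conj (B 0 1) := by
    apply mul_left_cancel₀ hB01
    rw [hr, hrdef]
    push_cast
    field_simp
    linear_combination (1 - ‖B 0 0‖ ^ 2 : ℂ) * Complex.mul_conj' (B 0 1)
  have hpos : 0 ≤ r := by
    refine div_nonneg ?_ (sq_nonneg _)
    have hre := h.commutator.re_trace_le
    have htr : (⁅A, B⁆ : GL (Fin 2) ℂ).1.trace =
        2 + (‖B 0 0‖ ^ 2 - 1) * (‖A 0 0 - A 1 1‖ ^ 2 : ℝ) := by
      have ha0 : A 0 0 ≠ 0 := left_ne_zero_of_mul_eq_one h0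
      have ha1 : A 1 1 ≠ 0 := left_ne_zero_of_mul_eq_one h1
      rw [commutatorElement_def]
      simp only [Units.val_mul, Matrix.coe_units_inv, Matrix.inv_def, Ring.inverse_eq_inv',
        Matrix.adjugate_fin_two, hAd]
      simp only [Matrix.trace_fin_two, Matrix.mul_apply, Fin.sum_univ_two, hA01, hA10,
        Matrix.smul_apply, Matrix.of_apply, Matrix.cons_val', Matrix.cons_val_zero,
        Matrix.cons_val_one, Matrix.cons_val_fin_one, smul_eq_mul]
      push_cast
      rw [← Complex.mul_conj' (A 0 0 - A 1 1), map_sub, eq_inv_of_mul_eq_one_right h0,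
        eq_inv_of_mul_eq_one_right h1]
      have hdet := Matrix.det_fin_two B.1
      field_simp
      linear_combination (-2 * A 0 0 * A 1 1) * hdet -
        (A 0 0 - A 1 1) ^ 2 * hr
    have hpos : 0 < ‖A 0 0 - A 1 1‖ ^ 2 := by
      have := norm_pos_iff.2 (sub_ne_zero.2 hne)
      positivity
    have hre' : (2 + (‖B 0 0‖ ^ 2 - 1) * ‖A 0 0 - A 1 1‖ ^ 2 : ℝ) ≤ 2 := by
      rw [htr] at hre
      exact_mod_cast hre
    nlinarith
  refine ⟨r, hpos, ?_⟩
  rintro X (rfl | rfl | hX)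
  · refine ⟨h.left.det_mul_conj, ?_, by simp [hA01, hA10]⟩
    rw [hAd]; linear_combination -X 1 1 * h0
  · exact ⟨hBd, hB11, hB10⟩
  · have hX11 := hdiag (h.mem X hX) (h.left_mul X hX)
    have hBX := hdiag (h.right_mul X hX) (by simpa [mul_assoc] using h.mul_mul X hX)
    have hXd := (h.mem X hX).det_mul_conj
    refine ⟨hXd, hX11, ?_⟩
    rw [Units.val_mul, Matrix.det_mul] at hBX
    simp only [Matrix.mul_apply, Fin.sum_univ_two, map_add, map_mul, hX11, hB10, hB11] at hBX
    have hz : X.1.det * conj (X 1 0) = -r * X 0 1 := by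
      apply mul_left_cancel₀ (mul_ne_zero hd0 ((map_ne_zero conj).2 hB01))
      linear_combination -hBX
    have hz' := congrArg conj hz
    simp only [map_mul, map_neg, Complex.conj_conj, Complex.conj_ofReal] at hz'
    linear_combination X.1.det * hz' - X 1 0 * hXd

end Unitary

/-- A `2 × 2` matrix is determined by four traces. -/
lemma Matrix.eq_of_trace_eq {K : Type*} [Field K] {A B X Y : Matrix (Fin 2) (Fin 2) K}
    (hA01 : A 0 1 = 0) (hA10 : A 1 0 = 0) (hne : A 0 0 ≠ A 1 1) (hB01 : B 0 1 ≠ 0)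
    (hB10 : B 1 0 ≠ 0) (h : X.trace = Y.trace) (hA : (A * X).trace = (A * Y).trace)
    (hB : (B * X).trace = (B * Y).trace) (hAB : (A * B * X).trace = (A * B * Y).trace) :
    X = Y := by
  simp only [Matrix.trace_fin_two, Matrix.mul_apply, Fin.sum_univ_two, hA01, hA10, zero_mul,
    add_zero, zero_add] at h hA hB hAB
  have hne' := sub_ne_zero.2 hne
  have e00 : X 0 0 = Y 0 0 := mul_left_cancel₀ hne' (by linear_combination hA - A 1 1 * h)
  have e11 : X 1 1 = Y 1 1 := by linear_combination h - e00
  have e10 : X 1 0 = Y 1 0 := mul_left_cancel₀ (mul_ne_zero hne' hB01) (by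
    linear_combination hAB - A 1 1 * hB - (A 0 0 - A 1 1) * B 0 0 * e00)
  have e01 : X 0 1 = Y 0 1 := mul_left_cancel₀ hB10 (by
    linear_combination hB - B 0 1 * e10 - B 0 0 * e00 - B 1 1 * e11)
  ext i j
  fin_cases i <;> fin_cases j <;> assumption

/-- An elliptic system over a number field generates a finite group. -/
lemma EllipticSystem.finite_closure_of_numberField {K : Type*} [Field K] [NumberField K]
    {A B : GL (Fin 2) K} {s : Set (GL (Fin 2) K)} (h : EllipticSystem A B s)
    (hA01 : A 0 1 = 0) (hA10 : A 1 0 = 0) (hne : A 0 0 ≠ A 1 1) (hB01 : B 0 1 ≠ 0)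
    (hB10 : B 1 0 ≠ 0) : (Subgroup.closure (insert A (insert B s)) : Set (GL (Fin 2) K)).Finite := by
  set G := Subgroup.closure (insert A (insert B s)) with hG
  have hfin : (insert A (insert B s)).Finite := (h.finite.insert B).insert A
  have htr : ∀ W ∈ G, W.1.trace ∈ {x : K | IsIntegral ℤ x ∧ ∀ σ : K →+* ℂ, ‖σ x‖ ≤ 2} := by
    intro W hW
    have hW' := h.mem_submonoid_closure hW
    refine ⟨Matrix.isIntegral_trace (GL2.isIntegral_of_mem_closure hfin h.isOfFinOrder_insert
      h.isOfFinOrder_mul_insert hW'), fun σ => ?_⟩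
    obtain ⟨r, hr, hX⟩ := (h.image (Matrix.GeneralLinearGroup.map σ)).exists_isUnitaryFor
      (by simp [hA01]) (by simp [hA10]) (σ.injective.ne hne) (by simpa using hB01)
    rw [← Set.image_insert_eq, ← Set.image_insert_eq] at hX
    have hu : IsUnitaryFor r (Matrix.GeneralLinearGroup.map σ W).1 := by
      clear hW
      induction hW' using Submonoid.closure_induction with
      | mem X h => exact hX _ ⟨X, h, rfl⟩
      | one => simpa using IsUnitaryFor.one
      | mul X Y _ _ h₁ h₂ =>
        rw [map_mul, Units.val_mul]
        exact h₁.mul h₂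
    simpa [Matrix.trace] using hu.norm_trace_le hr
  have hT := NumberField.Embeddings.finite_of_norm_le K ℂ 2
  have hAG : A ∈ G := Subgroup.subset_closure (Or.inl rfl)
  have hBG : B ∈ G := Subgroup.subset_closure (Or.inr (Or.inl rfl))
  refine Set.Finite.of_finite_image (f := fun W : GL (Fin 2) K => (W.1.trace, (A * W).1.trace,
    (B * W).1.trace, (A * B * W).1.trace)) ((hT.prod (hT.prod (hT.prod hT))).subset ?_) ?_
  · rintro _ ⟨W, hW, rfl⟩
    exact ⟨htr _ hW, htr _ (mul_mem hAG hW), htr _ (mul_mem hBG hW),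
      htr _ (mul_mem (mul_mem hAG hBG) hW)⟩
  · intro X _ Y _ hXY
    simp only [Prod.mk.injEq, Units.val_mul] at hXY
    obtain ⟨h₁, h₂, h₃, h₄⟩ := hXY
    exact Units.ext (Matrix.eq_of_trace_eq hA01 hA10 hne hB01 hB10 h₁ h₂ h₃ h₄)

/-- An elliptic system in `GL₂(ℂ)` with diagonal first element is defined over a number field. -/
lemma EllipticSystem.mem_algebraicClosure {A B : GL (Fin 2) ℂ} {s : Set (GL (Fin 2) ℂ)}
    (h : EllipticSystem A B s) (hA01 : A 0 1 = 0) (hA10 : A 1 0 = 0) (hne : A 0 0 ≠ A 1 1)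
    (hB01 : B 0 1 = 1) (hB10 : B 1 0 ≠ 0) :
    ∀ X ∈ insert A (insert B s), ∀ i j, X i j ∈ algebraicClosure ℚ ℂ := by
  have hint : ∀ {x : ℂ}, IsIntegral ℤ x → x ∈ algebraicClosure ℚ ℂ := fun hx =>
    mem_algebraicClosure_iff.2 (hx.tower_top (A := ℚ)).isAlgebraic
  have htr : ∀ {X : GL (Fin 2) ℂ}, IsOfFinOrder X → X.1.trace ∈ algebraicClosure ℚ ℂ :=
    fun hX => hint (Matrix.isIntegral_trace_complex hX.isIntegral_coe)
  have hA : A 0 0 ∈ algebraicClosure ℚ ℂ ∧ A 1 1 ∈ algebraicClosure ℚ ℂ := by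
    obtain ⟨n, hn, hU⟩ := isOfFinOrder_iff_pow_eq_one.1 h.left
    have hAdiag : A.1 = Matrix.diagonal ![A 0 0, A 1 1] := by
      ext i j
      fin_cases i <;> fin_cases j <;> simp [hA01, hA10]
    have hpow := congrArg Units.val hU
    rw [Units.val_pow_eq_pow_val, hAdiag, Matrix.diagonal_pow] at hpow
    refine ⟨hint (.of_pow hn ?_), hint (.of_pow hn ?_)⟩
    · have := congrFun (congrFun hpow 0) 0
      simp at this
      rw [this]
      exact isIntegral_one
    · have := congrFun (congrFun hpow 1) 1
      simp at this
      rw [this]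
      exact isIntegral_one
  have hdiag : ∀ {X : GL (Fin 2) ℂ}, IsOfFinOrder X → IsOfFinOrder (A * X) →
      X 0 0 ∈ algebraicClosure ℚ ℂ ∧ X 1 1 ∈ algebraicClosure ℚ ℂ := by
    intro X hX hAX
    have e₁ : X 0 0 = ((A * X).1.trace - A 1 1 * X.1.trace) / (A 0 0 - A 1 1) := by
      rw [eq_div_iff (sub_ne_zero.2 hne)]
      simp only [Units.val_mul, Matrix.trace_fin_two, Matrix.mul_apply, Fin.sum_univ_two, hA01,
        hA10]
      ring
    have e₂ : X 1 1 = X.1.trace - X 0 0 := by rw [Matrix.trace_fin_two]; ring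
    have h₀ : X 0 0 ∈ algebraicClosure ℚ ℂ := by
      rw [e₁]
      exact div_mem (sub_mem (htr hAX) (mul_mem hA.2 (htr hX))) (sub_mem hA.1 hA.2)
    exact ⟨h₀, by rw [e₂]; exact sub_mem (htr hX) h₀⟩
  have hmat : ∀ {X : GL (Fin 2) ℂ}, X 0 0 ∈ algebraicClosure ℚ ℂ → X 0 1 ∈ algebraicClosure ℚ ℂ →
      X 1 0 ∈ algebraicClosure ℚ ℂ → X 1 1 ∈ algebraicClosure ℚ ℂ →
      ∀ i j, X i j ∈ algebraicClosure ℚ ℂ := by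
    intro X h₁ h₂ h₃ h₄ i j
    fin_cases i <;> fin_cases j <;> assumption
  obtain ⟨hB0, hB1⟩ := hdiag h.right h.mul
  have hB2 : B 1 0 ∈ algebraicClosure ℚ ℂ := by
    have e : B 1 0 = B 0 0 * B 1 1 - B.1.det := by rw [Matrix.det_fin_two, hB01]; ring
    rw [e]
    exact sub_mem (mul_mem hB0 hB1) (hint h.right.isIntegral_det)
  rintro X (rfl | rfl | hX)
  · exact hmat hA.1 (hA01 ▸ zero_mem _) (hA10 ▸ zero_mem _) hA.2
  · exact hmat hB0 (hB01 ▸ one_mem _) hB2 hB1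
  · obtain ⟨h₀, h₁⟩ := hdiag (h.mem X hX) (h.left_mul X hX)
    obtain ⟨k₀, k₁⟩ := hdiag (h.right_mul X hX) (by simpa [mul_assoc] using h.mul_mul X hX)
    have e₀ : X 1 0 = (B * X) 0 0 - B 0 0 * X 0 0 := by
      rw [Units.val_mul, Matrix.mul_apply, Fin.sum_univ_two, hB01]; ring
    have e₁ : X 0 1 = ((B * X) 1 1 - B 1 1 * X 1 1) / B 1 0 := by
      rw [Units.val_mul, Matrix.mul_apply, Fin.sum_univ_two, eq_div_iff hB10]; ring
    refine hmat h₀ ?_ ?_ h₁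
    · rw [e₁]
      exact div_mem (sub_mem k₁ (mul_mem hB1 h₁)) hB2
    · rw [e₀]
      exact sub_mem k₀ (mul_mem hB0 h₀)

lemma EllipticSystem.finite_closure_of_diagonal {A B : GL (Fin 2) ℂ} {s : Set (GL (Fin 2) ℂ)}
    (h : EllipticSystem A B s) (hA01 : A 0 1 = 0) (hA10 : A 1 0 = 0) (hne : A 0 0 ≠ A 1 1)
    (hB01 : B 0 1 = 1) (hB10 : B 1 0 ≠ 0) :
    (Subgroup.closure (insert A (insert B s)) : Set (GL (Fin 2) ℂ)).Finite := by
  set S : Set ℂ := ⋃ i, ⋃ j, (fun X : GL (Fin 2) ℂ => X i j) '' insert A (insert B s) with hS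
  have hSfin : S.Finite := Set.finite_iUnion fun i => Set.finite_iUnion fun j =>
    ((h.finite.insert B).insert A).image _
  have hSint : ∀ x ∈ S, IsIntegral ℚ x := by
    intro x hx
    simp only [hS, Set.mem_iUnion] at hx
    obtain ⟨i, j, X, hX, rfl⟩ := hx
    exact (mem_algebraicClosure_iff.1
      (h.mem_algebraicClosure hA01 hA10 hne hB01 hB10 X hX i j)).isIntegral
  let K := IntermediateField.adjoin ℚ S
  have : Finite S := hSfin
  have : FiniteDimensional ℚ K := IntermediateField.finiteDimensional_adjoin hSint
  have : NumberField K := ⟨⟩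
  let f : GL (Fin 2) K →* GL (Fin 2) ℂ := Matrix.GeneralLinearGroup.map (algebraMap K ℂ)
  have hf : Function.Injective f := fun X Y hXY => Units.ext <|
    Matrix.map_injective (algebraMap K ℂ).injective (congrArg Units.val hXY)
  have hlift : ∀ X ∈ insert A (insert B s), ∃ Y, f Y = X := by
    intro X hX
    have hmem : ∀ i j, X i j ∈ K := fun i j => IntermediateField.subset_adjoin ℚ S <|
      Set.mem_iUnion.2 ⟨i, Set.mem_iUnion.2 ⟨j, X, hX, rfl⟩⟩
    let M : Matrix (Fin 2) (Fin 2) K := Matrix.of fun i j => ⟨X i j, hmem i j⟩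
    have hM : (algebraMap K ℂ).mapMatrix M = X.1 := rfl
    have hdet : M.det ≠ 0 := fun h0 => X.det_ne_zero (by
      rw [← hM, ← RingHom.map_det, h0, map_zero])
    exact ⟨Matrix.GeneralLinearGroup.mkOfDetNeZero M hdet, Units.ext hM⟩
  obtain ⟨A', hA⟩ := hlift A (Or.inl rfl)
  obtain ⟨B', hB⟩ := hlift B (Or.inr (Or.inl rfl))
  obtain ⟨s', hs⟩ : ∃ s', f '' s' = s :=
    ⟨f ⁻¹' s, Set.image_preimage_eq_of_subset fun X hX => hlift X (Or.inr (Or.inr hX))⟩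
  have h' : EllipticSystem (f A') (f B') (f '' s') := by rwa [hA, hB, hs]
  have hfA : ∀ i j, A i j = algebraMap K ℂ (A' i j) := fun i j => by rw [← hA]; rfl
  have hfB : ∀ i j, B i j = algebraMap K ℂ (B' i j) := fun i j => by rw [← hB]; rfl
  rw [← hA, ← hB, ← hs, ← Set.image_insert_eq, ← Set.image_insert_eq, ← MonoidHom.map_closure]
  refine Set.Finite.image f ((EllipticSystem.of_image hf h').finite_closure_of_numberField
    ?_ ?_ ?_ ?_ ?_)
  · rwa [hfA, map_eq_zero] at hA01
  · rwa [hfA, map_eq_zero] at hA10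
  · rw [hfA, hfA] at hne
    exact fun h => hne (congrArg _ h)
  · intro h0
    rw [hfB, h0, map_zero] at hB01
    exact zero_ne_one hB01
  · rwa [hfB, map_ne_zero] at hB10

/-- A matrix of finite order that is not central can be diagonalised with distinct eigenvalues. -/
lemma GL2.exists_conj_diagonal {A B : GL (Fin 2) ℂ} (hAB : ¬ Commute A B) (hA : IsOfFinOrder A) :
    ∃ P : GL (Fin 2) ℂ, (MulAut.conj P A) 0 1 = 0 ∧ (MulAut.conj P A) 1 0 = 0 ∧
      (MulAut.conj P A) 0 0 ≠ (MulAut.conj P A) 1 1 := by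
  obtain ⟨l, m, ht, hd, -, -⟩ := hA.exists_eigenvalues
  have hlm : l ≠ m := by
    rintro rfl
    refine hAB (Units.ext ?_)
    rw [Units.val_mul, Units.val_mul, hA.eq_scalar (l := l) (by rw [ht]; ring) (by rw [hd]; ring)]
    simp
  have hvec : ∀ z : ℂ, z ^ 2 - A.1.trace * z + A.1.det = 0 → ∃ v : Fin 2 → ℂ, v ≠ 0 ∧
      A 0 0 * v 0 + A 0 1 * v 1 = v 0 * z ∧ A 1 0 * v 0 + A 1 1 * v 1 = v 1 * z := by
    intro z hz
    rw [Matrix.trace_fin_two, Matrix.det_fin_two] at hz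
    obtain ⟨v, hv, hAv⟩ := (Matrix.exists_mulVec_eq_zero_iff (M := A.1 - z • 1)).2 (by
      rw [Matrix.det_fin_two]
      simp
      linear_combination hz)
    refine ⟨v, hv, ?_, ?_⟩
    · have := congrFun hAv 0
      simp [Matrix.mulVec, dotProduct, Fin.sum_univ_two] at this
      linear_combination this
    · have := congrFun hAv 1
      simp [Matrix.mulVec, dotProduct, Fin.sum_univ_two] at this
      linear_combination this
  obtain ⟨v, hv, hv0, hv1⟩ := hvec l (by rw [ht, hd]; ring)
  obtain ⟨w, hw, hw0, hw1⟩ := hvec m (by rw [ht, hd]; ring)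
  have hne := sub_ne_zero.2 hlm
  have hdet : (!![v 0, w 0; v 1, w 1] : Matrix (Fin 2) (Fin 2) ℂ).det ≠ 0 := by
    rw [Matrix.det_fin_two_of]
    intro h0
    have h00 : v 0 * w 0 = 0 := mul_left_cancel₀ hne (by
      linear_combination w 0 * (-hv0) + v 0 * hw0 - A 0 1 * h0)
    have h01 : v 0 * w 1 = 0 := mul_left_cancel₀ hne (by
      linear_combination -w 0 * hv1 + v 0 * hw1 - (A 1 1 - l) * h0)
    have h10 : v 1 * w 0 = 0 := by linear_combination h01 - h0
    have h11 : v 1 * w 1 = 0 := mul_left_cancel₀ hne (by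
      linear_combination w 1 * (-hv1) + v 1 * hw1 + A 1 0 * h0)
    obtain ⟨i, hi⟩ := Function.ne_iff.1 hv
    obtain ⟨j, hj⟩ := Function.ne_iff.1 hw
    fin_cases i <;> fin_cases j <;> simp_all
  set Q := Matrix.GeneralLinearGroup.mkOfDetNeZero _ hdet with hQ
  have hAQ : A.1 * Q.1 = Q.1 * Matrix.diagonal ![l, m] := by
    ext i j
    fin_cases i <;> fin_cases j <;>
      simp [hQ, Matrix.GeneralLinearGroup.mkOfDetNeZero, Matrix.mul_apply, Fin.sum_univ_two, hv0,
        hv1, hw0, hw1]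
  have hconj : (MulAut.conj Q⁻¹ A).1 = Matrix.diagonal ![l, m] := by
    rw [MulAut.conj_apply, inv_inv, Units.val_mul, Units.val_mul, mul_assoc, hAQ, ← mul_assoc,
      Units.inv_mul, one_mul]
  exact ⟨Q⁻¹, by rw [hconj]; simp, by rw [hconj]; simp, by rw [hconj]; simpa using hlm⟩

lemma GL2.mul_ne_zero_of_diagonal {A B : GL (Fin 2) ℂ} (hAB : ¬ Commute A B)
    (hcomm : IsOfFinOrder ⁅A, B⁆) (hA01 : A 0 1 = 0) (hA10 : A 1 0 = 0) :
    B 0 1 * B 1 0 ≠ 0 := by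
  intro h0
  apply hAB
  rw [← commutatorElement_eq_one_iff_commute]
  refine Units.ext ((hcomm.eq_scalar (l := 1) ?_ ?_).trans (one_smul _ _))
  · have hAd : A.1.det = A 0 0 * A 1 1 := by rw [Matrix.det_fin_two, hA01]; ring
    have hB := Matrix.det_fin_two B.1
    have ha := A.det_ne_zero
    have hb := B.det_ne_zero
    have ha0 : A 0 0 ≠ 0 := left_ne_zero_of_mul (hAd ▸ ha)
    have ha1 : A 1 1 ≠ 0 := right_ne_zero_of_mul (hAd ▸ ha)
    rw [commutatorElement_def]
    simp only [Units.val_mul, Matrix.coe_units_inv, Matrix.inv_def, Ring.inverse_eq_inv',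
      Matrix.adjugate_fin_two, hAd]
    simp only [Matrix.trace_fin_two, Matrix.mul_apply, Fin.sum_univ_two, hA01, hA10,
      Matrix.smul_apply, Matrix.of_apply, Matrix.cons_val', Matrix.cons_val_zero,
      Matrix.cons_val_one, Matrix.cons_val_fin_one, smul_eq_mul]
    field_simp
    linear_combination (-2 * A 0 0 * A 1 1) * hB - ((A 0 0 - A 1 1) ^ 2) * h0
  · rw [one_pow, ← Matrix.GeneralLinearGroup.val_det_apply, map_commutatorElement,
      commutatorElement_eq_one_iff_commute.2 (Commute.all _ _), Units.val_one]

lemma GL2.exists_conj_scale {q : ℂ} (hq : q ≠ 0) :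
    ∃ D : GL (Fin 2) ℂ, ∀ X : GL (Fin 2) ℂ, (MulAut.conj D X) 0 0 = X 0 0 ∧
      (MulAut.conj D X) 1 1 = X 1 1 ∧ (MulAut.conj D X) 0 1 = X 0 1 / q ∧
      (MulAut.conj D X) 1 0 = X 1 0 * q := by
  let D : GL (Fin 2) ℂ := Matrix.GeneralLinearGroup.mkOfDetNeZero
    (Matrix.diagonal ![1, q]) (by simpa using hq)
  have hD : D.1 = Matrix.diagonal ![1, q] := rfl
  refine ⟨D, fun X => ?_⟩
  have hDX : D.1 * X.1 = (MulAut.conj D X).1 * D.1 := by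
    rw [← Units.val_mul, ← Units.val_mul]; simp
  have h := fun i j => congrFun (congrFun hDX i) j
  generalize (MulAut.conj D X) = Y at *
  simp only [hD, Matrix.diagonal_mul, Matrix.mul_diagonal] at h
  have h00 := h 0 0
  have h01 := h 0 1
  have h10 := h 1 0
  have h11 := h 1 1
  simp at h00 h01 h10 h11
  refine ⟨h00.symm, mul_left_cancel₀ hq (by linear_combination -h11), ?_, ?_⟩
  · rw [eq_div_iff hq, h01]
  · linear_combination -h10

/-- A noncommuting pair of elements of finite order with commutator of finite order can be
diagonalised and normalised. -/
lemma GL2.exists_conj_normal_form {A B : GL (Fin 2) ℂ} (hAB : ¬ Commute A B)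
    (hA : IsOfFinOrder A) (hcomm : IsOfFinOrder ⁅A, B⁆) :
    ∃ P : GL (Fin 2) ℂ, (MulAut.conj P A) 0 1 = 0 ∧ (MulAut.conj P A) 1 0 = 0 ∧
      (MulAut.conj P A) 0 0 ≠ (MulAut.conj P A) 1 1 ∧ (MulAut.conj P B) 0 1 = 1 ∧
      (MulAut.conj P B) 1 0 ≠ 0 := by
  obtain ⟨P, hA01, hA10, hne⟩ := GL2.exists_conj_diagonal hAB hA
  have h0 := GL2.mul_ne_zero_of_diagonal (A := MulAut.conj P A) (B := MulAut.conj P B)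
    (fun h => hAB ((MulAut.conj P).injective (by simpa using h.eq)))
    (by rw [← map_commutatorElement]; exact (MulAut.conj P).toMonoidHom.isOfFinOrder hcomm)
    hA01 hA10
  have hB10 := right_ne_zero_of_mul h0
  obtain ⟨D, hD⟩ := GL2.exists_conj_scale (left_ne_zero_of_mul h0)
  refine ⟨D * P, ?_⟩
  rw [map_mul, MulAut.mul_apply, MulAut.mul_apply]
  obtain ⟨h₁, h₂, h₃, h₄⟩ := hD (MulAut.conj P A)
  obtain ⟨-, -, k₁, k₂⟩ := hD (MulAut.conj P B)
  rw [h₁, h₂, h₃, h₄, k₁, k₂, hA01, hA10]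
  exact ⟨zero_div _, zero_mul _, hne, div_self (left_ne_zero_of_mul h0), mul_ne_zero hB10
    (left_ne_zero_of_mul h0)⟩

theorem EllipticSystem.finite_closure {A B : GL (Fin 2) ℂ} {s : Set (GL (Fin 2) ℂ)}
    (h : EllipticSystem A B s) (hAB : ¬ Commute A B) :
    (Subgroup.closure (insert A (insert B s)) : Set (GL (Fin 2) ℂ)).Finite := by
  obtain ⟨P, hA01, hA10, hne, hB01, hB10⟩ :=
    GL2.exists_conj_normal_form hAB h.left h.commutator
  have hfin := (h.image (MulAut.conj P).toMonoidHom).finite_closure_of_diagonal hA01 hA10 hne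
    hB01 hB10
  rw [← Set.image_insert_eq, ← Set.image_insert_eq, ← MonoidHom.map_closure] at hfin
  exact hfin.of_finite_image (MulAut.conj P).injective.injOn

namespace SurfaceGroup

variable {g : ℕ} {ρ : SurfaceGroup g →* GL (Fin 2) ℂ}

lemma a_mem_handleWords (i : Fin g) : a i ∈ handleWords i := Or.inl rfl

lemma b_inv_mem_handleWords (i : Fin g) : (b i)⁻¹ ∈ handleWords i := Or.inr (Or.inl rfl)

lemma a_mul_b_inv_mem_handleWords (i : Fin g) : a i * (b i)⁻¹ ∈ handleWords i :=
  Or.inr (Or.inr rfl)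

lemma closure_a_b_inv : Subgroup.closure {x : SurfaceGroup g | ∃ i, x = a i ∨ x = (b i)⁻¹} = ⊤ := by
  rw [← top_le_iff, ← closure_generators, Subgroup.closure_le]
  rintro _ (⟨i, rfl⟩ | ⟨i, rfl⟩)
  · exact Subgroup.subset_closure ⟨i, Or.inl rfl⟩
  · rw [← inv_inv (b i)]
    exact inv_mem (Subgroup.subset_closure ⟨i, Or.inr rfl⟩)

/-- A group generated by finitely many commuting elements of finite order is finite. -/
lemma _root_.Subgroup.finite_closure_of_commute {G : Type*} [Group G] {s : Set G} (hs : s.Finite)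
    (hc : ∀ x ∈ s, ∀ y ∈ s, x * y = y * x) (ho : ∀ x ∈ s, IsOfFinOrder x) :
    (Subgroup.closure s : Set G).Finite := by
  have := Subgroup.isMulCommutative_closure hc
  let _ : CommGroup (Subgroup.closure s) :=
    { (inferInstance : Group (Subgroup.closure s)) with
      mul_comm := fun x y => Subtype.ext (setLike_mul_comm x.2 y.2) }
  have : Group.FG (Subgroup.closure s) := by
    rw [Group.fg_iff_subgroup_fg]
    exact ⟨hs.toFinset, by simp⟩
  have h : IsMulTorsion (Subgroup.closure s) := by
    rintro ⟨x, hx⟩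
    rw [← (Subgroup.subtype_injective _).isOfFinOrder_iff]
    induction hx using Subgroup.closure_induction with
    | mem x hx => exact ho x hx
    | one => exact IsOfFinOrder.one
    | mul x y hx hy h₁ h₂ => exact Commute.isOfFinOrder_mul (setLike_mul_comm hx hy) h₁ h₂
    | inv x hx h => exact h.inv
  have : Finite (Subgroup.closure s) := CommGroup.finite_of_fg_isMulTorsion _ h
  exact Set.toFinite _

/-- A finite-orbit representation for which every simple handle is mapped to a commuting pair has
finite image. -/
lemma finite_range_of_commute (h : FiniteAutOrbit ρ)
    (hc : ∀ (φ : MulAut (SurfaceGroup g)) (i : Fin g), Commute (ρ (φ (a i))) (ρ (φ (b i)))) :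
    (Set.range ρ).Finite := by
  have hsub : (Subgroup.closure (ρ '' {x | ∃ i, x = a i ∨ x = (b i)⁻¹}) : Set (GL (Fin 2) ℂ)) =
      Set.range ρ := by
    rw [← MonoidHom.map_closure, closure_a_b_inv, ← MonoidHom.range_eq_map, MonoidHom.coe_range]
  have hfin : {x : SurfaceGroup g | ∃ i, x = a i ∨ x = (b i)⁻¹}.Finite := by
    refine ((Set.finite_range a).union (Set.finite_range fun i => (b i)⁻¹)).subset ?_
    rintro _ ⟨i, rfl | rfl⟩
    · exact Or.inl ⟨i, rfl⟩
    · exact Or.inr ⟨i, rfl⟩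
  have hw : ∀ x : SurfaceGroup g, (∃ i, x = a i ∨ x = (b i)⁻¹) → ∃ i, x ∈ handleWords i := by
    rintro _ ⟨i, rfl | rfl⟩
    · exact ⟨i, a_mem_handleWords i⟩
    · exact ⟨i, b_inv_mem_handleWords i⟩
  rw [← hsub]
  refine Subgroup.finite_closure_of_commute (hfin.image ρ) ?_ ?_
  · rintro _ ⟨x, ⟨i, hx⟩, rfl⟩ _ ⟨y, ⟨j, hy⟩, rfl⟩
    have hx' : x ∈ handleWords i := hx.elim (· ▸ a_mem_handleWords i) (· ▸ b_inv_mem_handleWords i)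
    have hy' : y ∈ handleWords j := hy.elim (· ▸ a_mem_handleWords j) (· ▸ b_inv_mem_handleWords j)
    rcases lt_trichotomy i j with hij | rfl | hij
    · exact commute_handleWords hc hij hx' hy'
    · have h1 : Commute (ρ (a i)) (ρ (b i)) := hc 1 i
      rcases hx with rfl | rfl <;> rcases hy with rfl | rfl
      · rfl
      · simpa using h1.inv_right.eq
      · simpa using h1.symm.inv_left.eq
      · rfl
    · exact (commute_handleWords hc hij hy' hx').symm
  · rintro _ ⟨x, hx, rfl⟩
    obtain ⟨i, hi⟩ := hw x hx
    exact isOfFinOrder_handleWord h hi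

/-- A finite-orbit representation that does not commute on some handle has finite image. -/
lemma finite_range_of_not_commute (h : FiniteAutOrbit ρ) {i : Fin g}
    (hi : ¬ Commute (ρ (a i)) (ρ (b i))) : (Set.range ρ).Finite := by
  set s : Set (GL (Fin 2) ℂ) := {x | ∃ j ≠ i, x = ρ (a j) ∨ x = ρ (b j)⁻¹} with hs
  have hfin : s.Finite := by
    refine ((Set.finite_range fun j => ρ (a j)).union
      (Set.finite_range fun j => ρ (b j)⁻¹)).subset ?_
    rintro _ ⟨j, -, rfl | rfl⟩
    · exact Or.inl ⟨j, rfl⟩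
    · exact Or.inr ⟨j, rfl⟩
  have hsub : Set.range ρ ⊆ Subgroup.closure (insert (ρ (a i)) (insert (ρ (b i)⁻¹) s)) := by
    rw [← MonoidHom.coe_range, MonoidHom.range_eq_map, ← closure_a_b_inv, MonoidHom.map_closure,
      SetLike.coe_subset_coe]
    refine Subgroup.closure_mono ?_
    rintro _ ⟨_, ⟨j, hj⟩, rfl⟩
    rcases eq_or_ne j i with rfl | hji
    · rcases hj with rfl | rfl
      · exact Or.inl rfl
      · exact Or.inr (Or.inl rfl)
    · exact Or.inr (Or.inr ⟨j, hji, hj.imp (congrArg ρ) (congrArg ρ)⟩)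
  have hw : ∀ x ∈ s, ∃ j ≠ i, ∃ y ∈ handleWords j, ρ y = x := by
    rintro _ ⟨j, hj, rfl | rfl⟩
    · exact ⟨j, hj, _, a_mem_handleWords j, rfl⟩
    · exact ⟨j, hj, _, b_inv_mem_handleWords j, rfl⟩
  have h₂ : ∀ {y}, y ∈ handleWords i → ∀ x ∈ s, IsOfFinOrder (ρ y * x) := fun hy x hx => by
    obtain ⟨j, hj, z, hz, rfl⟩ := hw x hx
    exact isOfFinOrder_handleWord_mul h hj.symm hy hz
  suffices hsys : EllipticSystem (ρ (a i)) (ρ (b i)⁻¹) s by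
    refine (hsys.finite_closure ?_).subset hsub
    rwa [map_inv, Commute.inv_right_iff]
  refine ⟨hfin, ?_, ?_, ?_, ?_, ?_, ?_, ?_, ?_, ?_⟩
  · exact isOfFinOrder_handleWord h (a_mem_handleWords i)
  · exact isOfFinOrder_handleWord h (b_inv_mem_handleWords i)
  · rw [← map_mul]
    exact isOfFinOrder_handleWord h (a_mul_b_inv_mem_handleWords i)
  · have e : ⁅ρ (a i), ρ (b i)⁻¹⁆ = (ρ (b i))⁻¹ * ⁅ρ (a i), ρ (b i)⁆⁻¹ * (ρ (b i))⁻¹⁻¹ := by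
      rw [map_inv]; simp only [commutatorElement_def]; group
    rw [e]
    exact isOfFinOrder_conj.2 (isOfFinOrder_commutator h hi).inv
  · intro x hx
    obtain ⟨j, -, z, hz, rfl⟩ := hw x hx
    exact isOfFinOrder_handleWord h hz
  · exact h₂ (a_mem_handleWords i)
  · exact h₂ (b_inv_mem_handleWords i)
  · rw [← map_mul]
    exact h₂ (a_mul_b_inv_mem_handleWords i)
  · rintro x ⟨j, hj, hx⟩ y ⟨k, hk, hy⟩
    rcases eq_or_ne j k with rfl | hjk
    · have hab : IsOfFinOrder (ρ (a j) * ρ (b j)⁻¹) := by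
        rw [← map_mul]
        exact isOfFinOrder_handleWord h (a_mul_b_inv_mem_handleWords j)
      have ha := isOfFinOrder_handleWord h (a_mem_handleWords j)
      have hb := isOfFinOrder_handleWord h (b_inv_mem_handleWords j)
      rcases hx with rfl | rfl <;> rcases hy with rfl | rfl
      · exact (Commute.refl _).isOfFinOrder_mul ha ha
      · exact hab
      · exact isOfFinOrder_mul_swap.1 hab
      · exact (Commute.refl _).isOfFinOrder_mul hb hb
    · have hw' : ∀ {j : Fin g} {x}, (x = ρ (a j) ∨ x = ρ (b j)⁻¹) →
          ∃ y ∈ handleWords j, ρ y = x := by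
        rintro j _ (rfl | rfl)
        · exact ⟨_, a_mem_handleWords j, rfl⟩
        · exact ⟨_, b_inv_mem_handleWords j, rfl⟩
      obtain ⟨x, hx', rfl⟩ := hw' hx
      obtain ⟨y, hy', rfl⟩ := hw' hy
      exact isOfFinOrder_handleWord_mul h hjk hx' hy'

end SurfaceGroup

/-- For `g = 2` or `g = 3`, every MCG-finite rank-`2` representation of the genus-`g`
surface group has finite image. -/
theorem finite_image_of_MCG_finite_rank_two_genus_two_three (g : ℕ)
    (hg : g = 2 ∨ g = 3)
    (ρ : SurfaceGroup g →* GL (Fin 2) ℂ)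
    (hfin : FiniteAutOrbit ρ) :
    Set.Finite (Set.range ⇑ρ) := by
  by_cases h : ∀ (φ : MulAut (SurfaceGroup g)) (i : Fin g),
      Commute (ρ (φ (SurfaceGroup.a i))) (ρ (φ (SurfaceGroup.b i)))
  · exact SurfaceGroup.finite_range_of_commute hfin h
  · push Not at h
    obtain ⟨φ, i, hi⟩ := h
    have := SurfaceGroup.finite_range_of_not_commute (hfin.comp φ) hi
    exact this.subset (Set.range_subset_iff.2 fun x => ⟨φ.symm x, by simp⟩)
end
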